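/- arXiv:2601.07097 — 2 statements merged into one kernel-verified Lean document; each statement's English description precedes it below -/
import Mathlib

section
/- For all b ≥ 2 and ε > 0 there is a constant C = C(b,ε) such that for all x and all D with x^{1/4} ≤ D ≤ x^{2/5}, one has S_b(x,D) ≤ C · x^{2/3} / D^{2/3−ε}. -/
/-- A positive integer `n` is a base-`b` palindrome if `b ∤ n` and its base-`b`
digit string reads the same forwards and backwards. -/
def IsBPalindrome (b n : ℕ) : Prop := ¬ b ∣ n ∧ (Nat.digits b n).Palindrome

/-- `𝒫*_b(x)`: base-`b` palindromes `n ≤ x` with `gcd(n, b³ - b) = 1`. -/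
def PstarSet (b : ℕ) (x : ℝ) : Set ℕ :=
  {n : ℕ | 0 < n ∧ (n : ℝ) ≤ x ∧ IsBPalindrome b n ∧ Nat.gcd n (b ^ 3 - b) = 1}

/-- `S_b(x, D)`: the number of `n ∈ 𝒫*_b(x)` divisible by `d²` for some
integer `d` with `D ≤ d ≤ 2D`. -/
noncomputable def Scount (b : ℕ) (x D : ℝ) : ℕ :=
  {n : ℕ | n ∈ PstarSet b x ∧ ∃ d : ℕ, D ≤ (d : ℝ) ∧ (d : ℝ) ≤ 2 * D ∧ d ^ 2 ∣ n}.ncard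

theorem card_cube_roots_of_unity_le (n : ℕ) (hn : n ≠ 0) :
    Nat.card {u : (ZMod n)ˣ // u ^ 3 = 1} ≤ 3 ^ n.primeFactors.card := by
  induction n using Nat.recOnPosPrimePosCoprime with
  | zero => exact absurd rfl hn
  | one =>
    have : Subsingleton {u : (ZMod 1)ˣ // u ^ 3 = 1} := inferInstance
    exact (Finite.card_le_one_iff_subsingleton.mpr this).trans (Nat.one_le_pow _ _ (by norm_num))
  | prime_pow p k hp hk =>
    have := Fact.mk hp
    rw [Nat.primeFactors_prime_pow hk.ne' hp, Finset.card_singleton, pow_one]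
    have : NeZero (p ^ k) := ⟨hn⟩
    by_cases h2 : p = 2
    · subst h2
      have hc : (Nat.card (ZMod (2 ^ k))ˣ).Coprime 3 := by
        rw [Nat.card_eq_fintype_card, ZMod.card_units_eq_totient, Nat.totient_prime_pow hp hk]
        norm_num
        exact Nat.Coprime.pow_left _ (by norm_num)
      have : Subsingleton {u : (ZMod (2 ^ k))ˣ // u ^ 3 = 1} := by
        constructor
        rintro ⟨u, hu⟩ ⟨v, hv⟩
        apply Subtype.ext
        apply (powCoprime hc).injective
        simp [powCoprime_apply, hu, hv]
      exact (Finite.card_le_one_iff_subsingleton.mpr this).trans (by norm_num)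
    · have : IsCyclic (ZMod (p ^ k))ˣ := ZMod.isCyclic_units_of_prime_pow p hp h2 k
      rw [Nat.card_eq_fintype_card, Fintype.card_subtype]
      exact IsCyclic.card_pow_eq_one_le (by norm_num)
  | coprime a c ha hc hac iha ihc =>
    rw [hac.primeFactors_mul, Finset.card_union_of_disjoint hac.disjoint_primeFactors, pow_add]
    refine le_trans ?_ (Nat.mul_le_mul (iha (by omega)) (ihc (by omega)))
    rw [← Nat.card_prod]
    have : NeZero a := ⟨by omega⟩
    have : NeZero c := ⟨by omega⟩
    let e : (ZMod (a * c))ˣ ≃* (ZMod a)ˣ × (ZMod c)ˣ :=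
      (Units.mapEquiv (ZMod.chineseRemainder hac).toMulEquiv).trans MulEquiv.prodUnits
    have he (u : (ZMod (a * c))ˣ) (hu : u ^ 3 = 1) : (e u).1 ^ 3 = 1 ∧ (e u).2 ^ 3 = 1 := by
      have : e u ^ 3 = 1 := by rw [← map_pow, hu, map_one]
      exact ⟨congrArg Prod.fst this, congrArg Prod.snd this⟩
    refine Nat.card_le_card_of_injective
      (fun u : {u : (ZMod (a * c))ˣ // u ^ 3 = 1} =>
        ((⟨(e u.1).1, (he u.1 u.2).1⟩ : {u : (ZMod a)ˣ // u ^ 3 = 1}),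
          (⟨(e u.1).2, (he u.1 u.2).2⟩ : {u : (ZMod c)ˣ // u ^ 3 = 1}))) ?_
    rintro ⟨u, hu⟩ ⟨v, hv⟩ h
    simp only [Prod.mk.injEq, Subtype.mk.injEq] at h
    exact Subtype.ext (e.injective (Prod.ext h.1 h.2))

theorem card_cubic_congruence_le (s : ℕ) (hs : 0 < s) (w l : ℤ) :
    ((Finset.range s).filter (fun r : ℕ => r.Coprime s ∧ (s : ℤ) ∣ w + (r : ℤ) ^ 3 * l)).card ≤
      3 ^ s.primeFactors.card * Int.gcd l s := by
  classical
  set A := (Finset.range s).filter (fun r : ℕ => r.Coprime s ∧ (s : ℤ) ∣ w + (r : ℤ) ^ 3 * l) with hA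
  rcases A.eq_empty_or_nonempty with h0 | ⟨r₁, hr₁⟩
  · simp [h0]
  set g := Int.gcd l s with hg
  have hgpos : 0 < g := Int.gcd_pos_of_ne_zero_right _ (by exact_mod_cast hs.ne')
  obtain ⟨s', hs'⟩ : g ∣ s := by
    have := Int.gcd_dvd_right l (s : ℤ)
    exact_mod_cast this
  have hs'pos : 0 < s' := by
    rcases Nat.eq_zero_or_pos s' with h | h
    · simp [h] at hs'; omega
    · exact h
  obtain ⟨l', hl'⟩ : (g : ℤ) ∣ l := Int.gcd_dvd_left l (s : ℤ)
  have hcop : IsCoprime (s' : ℤ) l' := by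
    rw [Int.isCoprime_iff_gcd_eq_one]
    have h1 : Int.gcd ((g : ℤ) * l') ((g : ℤ) * s') = g := by
      rw [← hl']; rw [hg]; congr 1; rw [← hg]; exact_mod_cast hs'.symm
    rw [Int.gcd_mul_left, Int.natAbs_natCast] at h1
    rw [Int.gcd_comm]
    exact Nat.eq_of_mul_eq_mul_left hgpos (by simpa using h1)
  have : NeZero s' := ⟨hs'pos.ne'⟩
  have hunit : ∀ r ∈ A, r.Coprime s' := fun r hr =>
    Nat.Coprime.coprime_dvd_right ⟨g, by rw [hs']; ring⟩ (Finset.mem_filter.mp hr).2.1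
  have hcube : ∀ r ∈ A, (r : ZMod s') ^ 3 = (r₁ : ZMod s') ^ 3 := by
    intro r hr
    have h1 := (Finset.mem_filter.mp hr).2.2
    have h2 := (Finset.mem_filter.mp hr₁).2.2
    have h3 := dvd_sub h1 h2
    have h4 : (g : ℤ) * s' ∣ g * (((r : ℤ) ^ 3 - (r₁ : ℤ) ^ 3) * l') := by
      have : (g : ℤ) * s' = s := by exact_mod_cast hs'.symm
      rw [this]
      have h5 : (g : ℤ) * (((r : ℤ) ^ 3 - (r₁ : ℤ) ^ 3) * l') =
          w + (r : ℤ) ^ 3 * l - (w + (r₁ : ℤ) ^ 3 * l) := by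
        linear_combination (-((r : ℤ) ^ 3 - (r₁ : ℤ) ^ 3)) * hl'
      rw [h5]
      exact h3
    have h5 := hcop.dvd_of_dvd_mul_right
      ((mul_dvd_mul_iff_left (by exact_mod_cast hgpos.ne' : (g : ℤ) ≠ 0)).mp h4)
    have h6 := (ZMod.intCast_zmod_eq_zero_iff_dvd _ s').mpr h5
    push_cast at h6
    exact sub_eq_zero.mp h6
  let R := {u : (ZMod s')ˣ // u ^ 3 = 1}
  let f : A → Fin g × R := fun r =>
    (⟨r.1 / s', by
      have := Finset.mem_range.mp (Finset.mem_filter.mp r.2).1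
      rw [Nat.div_lt_iff_lt_mul hs'pos, ← hs']; exact this⟩,
     ⟨ZMod.unitOfCoprime r.1 (hunit r.1 r.2) * (ZMod.unitOfCoprime r₁ (hunit r₁ hr₁))⁻¹, by
      rw [mul_pow, inv_pow, mul_inv_eq_one]
      ext
      simpa using hcube r.1 r.2⟩)
  have hf : Function.Injective f := by
    rintro ⟨r, hr⟩ ⟨t, ht⟩ h
    simp only [f, Prod.mk.injEq, Fin.mk.injEq] at h
    have h1 := congrArg Units.val (mul_right_cancel (congrArg Subtype.val h.2))
    simp only [ZMod.coe_unitOfCoprime] at h1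
    have h2 : r % s' = t % s' := (ZMod.natCast_eq_natCast_iff r t s').mp h1
    apply Subtype.ext
    change r = t
    rw [← Nat.div_add_mod r s', ← Nat.div_add_mod t s', h.1, h2]
  have h1 := Nat.card_le_card_of_injective f hf
  rw [Nat.card_prod] at h1
  simp only [Nat.card_eq_fintype_card, Fintype.card_coe, Fintype.card_fin] at h1
  rw [← Nat.card_eq_fintype_card] at h1
  have h2 := card_cube_roots_of_unity_le s' hs'pos.ne'
  have h3 : s'.primeFactors.card ≤ s.primeFactors.card :=
    Finset.card_le_card (Nat.primeFactors_mono ⟨g, by rw [hs']; ring⟩ hs.ne')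
  calc A.card ≤ g * Nat.card R := h1
    _ ≤ g * 3 ^ s.primeFactors.card :=
      Nat.mul_le_mul_left _ (h2.trans (Nat.pow_le_pow_right (by norm_num) h3))
    _ = _ := mul_comm _ _

theorem sum_gcd_Icc_le (s L : ℕ) (hs : 0 < s) :
    ∑ l ∈ Finset.Icc 1 L, Nat.gcd l s ≤ s.divisors.card * L := by
  calc ∑ l ∈ Finset.Icc 1 L, Nat.gcd l s
      ≤ ∑ l ∈ Finset.Icc 1 L, ∑ g ∈ s.divisors, if g ∣ l then g else 0 := by
        refine Finset.sum_le_sum fun l _ => ?_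
        have := Finset.single_le_sum (f := fun g => if g ∣ l then g else 0)
          (fun _ _ => Nat.zero_le _)
          (Nat.mem_divisors.mpr ⟨Nat.gcd_dvd_right l s, hs.ne'⟩)
        simpa [Nat.gcd_dvd_left] using this
    _ = ∑ g ∈ s.divisors, ∑ l ∈ Finset.Icc 1 L, if g ∣ l then g else 0 := Finset.sum_comm
    _ ≤ ∑ g ∈ s.divisors, L := by
        refine Finset.sum_le_sum fun g _ => ?_
        rw [← Finset.sum_filter, Finset.sum_const, smul_eq_mul]
        have : ((Finset.Icc 1 L).filter (fun l => g ∣ l)).card = L / g := by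
          rw [← Nat.Ioc_filter_dvd_card_eq_div]; rfl
        rw [this]
        exact Nat.div_mul_le_self L g
    _ = _ := by simp

theorem card_divisors_pow_le (b k : ℕ) (hb : b ≠ 0) :
    (b ^ k).divisors.card ≤ (b * k + 1) ^ b := by
  rw [Nat.card_divisors (pow_ne_zero _ hb)]
  calc ∏ p ∈ (b ^ k).primeFactors, ((b ^ k).factorization p + 1)
      ≤ ∏ p ∈ (b ^ k).primeFactors, (b * k + 1) := by
        refine Finset.prod_le_prod' fun p _ => ?_
        rw [Nat.factorization_pow]
        have := (Nat.factorization_lt (n := b) p hb).le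
        simp only [Finsupp.smul_apply, smul_eq_mul]
        nlinarith
    _ = (b * k + 1) ^ (b ^ k).primeFactors.card := by simp
    _ ≤ (b * k + 1) ^ b := by
        refine Nat.pow_le_pow_right (by omega) ?_
        refine (Finset.card_le_card (t := Finset.Icc 1 b) fun p hp => ?_).trans (by simp)
        have hpp := Nat.prime_of_mem_primeFactors hp
        exact Finset.mem_Icc.mpr ⟨hpp.pos, Nat.le_of_dvd (Nat.pos_of_ne_zero hb)
          (hpp.dvd_of_dvd_pow (Nat.dvd_of_mem_primeFactors hp))⟩

theorem sum_int_gcd_le (s L : ℕ) (hs : 0 < s) :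
    ∑ l ∈ (Finset.Icc (-(L : ℤ)) L).erase 0, Int.gcd l s ≤ 2 * (s.divisors.card * L) := by
  classical
  have hsub : (Finset.Icc (-(L : ℤ)) L).erase 0 ⊆
      (Finset.Icc 1 L).image (fun l : ℕ => (l : ℤ)) ∪
        (Finset.Icc 1 L).image (fun l : ℕ => -(l : ℤ)) := by
    intro l hl
    rw [Finset.mem_erase, Finset.mem_Icc] at hl
    rw [Finset.mem_union, Finset.mem_image, Finset.mem_image]
    rcases lt_or_gt_of_ne hl.1 with h | h
    · exact Or.inr ⟨l.natAbs, Finset.mem_Icc.mpr (by omega), by omega⟩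
    · exact Or.inl ⟨l.natAbs, Finset.mem_Icc.mpr (by omega), by omega⟩
  calc _ ≤ _ := Finset.sum_le_sum_of_subset hsub
    _ ≤ ∑ l ∈ (Finset.Icc 1 L).image (fun l : ℕ => (l : ℤ)), Int.gcd l s +
        ∑ l ∈ (Finset.Icc 1 L).image (fun l : ℕ => -(l : ℤ)), Int.gcd l s := by
      rw [← Finset.sum_union_inter]
      exact Nat.le_add_right _ _
    _ = ∑ l ∈ Finset.Icc 1 L, Nat.gcd l s + ∑ l ∈ Finset.Icc 1 L, Nat.gcd l s := by
      rw [Finset.sum_image (by intro a _ b _ h; simpa using h),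
        Finset.sum_image (by intro a _ b _ h; simpa using h)]
      simp
    _ ≤ _ := by
      have := sum_gcd_Icc_le s L hs
      omega

theorem card_le_of_spread (A : Finset ℕ) {B : ℝ} (hB : 0 ≤ B)
    (h : ∀ x ∈ A, ∀ y ∈ A, x ≤ y → (y : ℝ) - x ≤ B) : (A.card : ℝ) ≤ B + 1 := by
  rcases A.eq_empty_or_nonempty with rfl | hne
  · simp; linarith
  · have h1 := h _ (A.min'_mem hne) _ (A.max'_mem hne) (A.min'_le_max' hne)
    have h2 : A ⊆ Finset.Icc (A.min' hne) (A.max' hne) := fun x hx =>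
      Finset.mem_Icc.mpr ⟨A.min'_le x hx, A.le_max' x hx⟩
    have h3 := Finset.card_le_card h2
    rw [Nat.card_Icc] at h3
    have h4 : A.card + A.min' hne ≤ A.max' hne + 1 := by
      have := A.min'_le_max' hne
      omega
    have h5 : (A.card : ℝ) + A.min' hne ≤ A.max' hne + 1 := by exact_mod_cast h4
    linarith

theorem inv_sq_second_difference_le {D p e δ : ℝ} (hD : 0 < D) (he : 0 ≤ e) (hδ : 0 ≤ δ)
    (hp : D ≤ p) (hq : p + e + δ ≤ 2 * D) :
    δ * e / (16 * D ^ 4) ≤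
      1 / p ^ 2 - 1 / (p + δ) ^ 2 - (1 / (p + e) ^ 2 - 1 / (p + e + δ) ^ 2) := by
  have hp0 : 0 < p := by linarith
  have hid (u : ℝ) (hu : 0 < u) :
      1 / u ^ 2 - 1 / (u + δ) ^ 2 = δ * (1 / (u * (u + δ) ^ 2) + 1 / (u ^ 2 * (u + δ))) := by
    have : 0 < u + δ := by linarith
    field_simp
    ring
  rw [hid p hp0, hid (p + e) (by linarith), ← mul_sub, mul_div_assoc]
  refine mul_le_mul_of_nonneg_left ?_ hδ
  have h1 : 1 / ((p + e) ^ 2 * (p + e + δ)) ≤ 1 / (p ^ 2 * (p + δ)) := by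
    apply one_div_le_one_div_of_le (by positivity)
    gcongr <;> linarith
  have h2 : 1 / ((p + e) * (p + e + δ) ^ 2) ≤ 1 / ((p + e) * (p + δ) ^ 2) := by
    apply one_div_le_one_div_of_le (by positivity)
    gcongr
    linarith
  have h3 : 1 / (p * (p + δ) ^ 2) - 1 / ((p + e) * (p + δ) ^ 2) =
      e / (p * (p + e) * (p + δ) ^ 2) := by
    have : 0 < p + δ := by linarith
    field_simp
    ring
  have h4 : e / (16 * D ^ 4) ≤ e / (p * (p + e) * (p + δ) ^ 2) := by
    apply div_le_div_of_nonneg_left he (by positivity)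
    calc p * (p + e) * (p + δ) ^ 2 ≤ (2 * D) * (2 * D) * (2 * D) ^ 2 := by
          gcongr <;> linarith
      _ = 16 * D ^ 4 := by ring
  linarith

theorem abs_sub_div_sq_le {D d m N t : ℝ} (hD : 0 < D) (hd : D ≤ d)
    (h : |m * d ^ 2 - N| ≤ t) : |m - N / d ^ 2| ≤ t / D ^ 2 := by
  have hd0 : 0 < d := by linarith
  have h1 : m - N / d ^ 2 = (m * d ^ 2 - N) / d ^ 2 := by field_simp
  rw [h1, abs_div, abs_of_pos (by positivity : 0 < d ^ 2)]
  have : 0 ≤ t := (abs_nonneg _).trans h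
  gcongr

/-- Two translates by the same vector `(δ, m₁' - m₁)` of points near the curve `m d² = N`
start at nearby abscissae. -/
theorem mul_gap_le {D d₁ d₂ δ m₁ m₁' m₂ m₂' t : ℝ} (hD : 0 < D) (hδ : 0 ≤ δ)
    (h₁ : D ≤ d₁) (h₁₂ : d₁ ≤ d₂) (h₂ : d₂ + δ ≤ 2 * D)
    (ht₁ : |m₁' * (d₁ + δ) ^ 2 - m₁ * d₁ ^ 2| ≤ t)
    (ht₂ : |m₂ * d₂ ^ 2 - m₁ * d₁ ^ 2| ≤ t)
    (ht₂' : |m₂' * (d₂ + δ) ^ 2 - m₁ * d₁ ^ 2| ≤ t)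
    (hm : m₁' - m₁ = m₂' - m₂) (hN : 0 ≤ m₁ * d₁ ^ 2) :
    m₁ * d₁ ^ 2 * (δ * (d₂ - d₁)) ≤ 48 * t * D ^ 2 := by
  have hd0 : 0 < d₁ := by linarith
  have hm₁ : m₁ = m₁ * d₁ ^ 2 / d₁ ^ 2 := by field_simp
  set N := m₁ * d₁ ^ 2 with hNdef
  have e1 := abs_le.mp (abs_sub_div_sq_le hD (by linarith) ht₁)
  have e2 := abs_le.mp (abs_sub_div_sq_le hD (by linarith) ht₂)
  have e3 := abs_le.mp (abs_sub_div_sq_le hD (by linarith) ht₂')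
  have h := inv_sq_second_difference_le (p := d₁) (e := d₂ - d₁) hD (by linarith) hδ h₁
    (by linarith)
  rw [add_sub_cancel] at h
  have h5 := mul_le_mul_of_nonneg_left h hN
  have h6 : N * (1 / d₁ ^ 2 - 1 / (d₁ + δ) ^ 2 - (1 / d₂ ^ 2 - 1 / (d₂ + δ) ^ 2)) =
      N / d₁ ^ 2 - N / (d₁ + δ) ^ 2 - (N / d₂ ^ 2 - N / (d₂ + δ) ^ 2) := by ring
  rw [h6] at h5
  have h7 : N * (δ * (d₂ - d₁) / (16 * D ^ 4)) ≤ 3 * (t / D ^ 2) := by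
    linarith [e1.1, e1.2, e2.1, e2.2, e3.1, e3.2]
  have h8 : N * (δ * (d₂ - d₁) / (16 * D ^ 4)) = N * (δ * (d₂ - d₁)) / (16 * D ^ 4) := by ring
  rw [h8, div_le_iff₀ (by positivity)] at h7
  calc _ ≤ _ := h7
    _ = _ := by
      field_simp
      ring

theorem abs_sub_le_of_near_curve {D y d δ m m' t : ℝ} (hD : 0 < D) (hδ : 0 ≤ δ)
    (hd : D ≤ d) (hm : 0 ≤ m) (hy : m * d ^ 2 ≤ y)
    (ht : |m' * (d + δ) ^ 2 - m * d ^ 2| ≤ t) :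
    |m' - m| ≤ t / D ^ 2 + 2 * y * δ / D ^ 3 := by
  have hd0 : 0 < d := by linarith
  have e1 := abs_sub_div_sq_le hD (by linarith) ht
  have h1 : |m * d ^ 2 / (d + δ) ^ 2 - m| ≤ 2 * y * δ / D ^ 3 := by
    have h2 : m * d ^ 2 / (d + δ) ^ 2 - m =
        -((m * d ^ 2) * δ * ((2 * d + δ) / (d ^ 2 * (d + δ) ^ 2))) := by
      field_simp
      ring
    have h3 : (2 * d + δ) / (d ^ 2 * (d + δ) ^ 2) ≤ 2 / D ^ 3 := by
      calc (2 * d + δ) / (d ^ 2 * (d + δ) ^ 2) ≤ (2 * (d + δ)) / (d ^ 2 * (d + δ) ^ 2) := by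
            gcongr; linarith
        _ = 2 / (d ^ 2 * (d + δ)) := by field_simp
        _ ≤ 2 / (D ^ 2 * D) := by gcongr; linarith
        _ = 2 / D ^ 3 := by ring
    have hy0 : 0 ≤ y := le_trans (by positivity) hy
    rw [h2, abs_neg, abs_of_nonneg (by positivity)]
    calc _ ≤ y * δ * (2 / D ^ 3) := by gcongr
      _ = _ := by ring
  calc |m' - m| = |(m' - m * d ^ 2 / (d + δ) ^ 2) + (m * d ^ 2 / (d + δ) ^ 2 - m)| := by
        congr 1; ring
    _ ≤ _ := (abs_add_le _ _).trans (add_le_add e1 h1)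

theorem exists_shift_of_near {s d d' m m' : ℕ} {D y β : ℝ} (hs : 0 < s) (hβ : 1 ≤ β)
    (hD : 1 ≤ D) (hcop : (d ^ 2 * m).Coprime s)
    (hmod : d ^ 2 * m ≡ d' ^ 2 * m' [MOD s ^ 2]) (hdd : d ≡ d' [MOD s]) (hle : d ≤ d')
    (hne : d ^ 2 * m ≠ d' ^ 2 * m') (hd : D ≤ d) (hd2 : d ≤ 2 * D)
    (hlow : y ≤ β * (d ^ 2 * m : ℕ))
    (hclose : |((d' ^ 2 * m' : ℕ) : ℝ) - (d ^ 2 * m : ℕ)| ≤ y / s ^ 2)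
    (H1 : 2 * β * D < s ^ 4) (H2 : y < s ^ 4 * D ^ 2) :
    ∃ j : ℕ, ∃ l : ℤ, 0 < j ∧ l ≠ 0 ∧ d' = d + s * j ∧ (m' : ℤ) = m + s * l ∧
      (s : ℤ) ∣ 2 * j * (d ^ 2 * m : ℕ) + (d : ℤ) ^ 3 * l := by
  have hsR : (0 : ℝ) < s := by exact_mod_cast hs
  have hcd : d.Coprime s :=
    Nat.Coprime.coprime_dvd_left ⟨d * m, by ring⟩ hcop
  have hcm : m.Coprime s := Nat.Coprime.coprime_dvd_left ⟨d ^ 2, by ring⟩ hcop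
  have hcdZ : IsCoprime (s : ℤ) (d : ℤ) := (Nat.isCoprime_iff_coprime.mpr hcd).symm
  have hcmZ : IsCoprime (s : ℤ) (m : ℤ) := (Nat.isCoprime_iff_coprime.mpr hcm).symm
  obtain ⟨j, hj⟩ : ∃ j, d' = d + s * j := by
    obtain ⟨j, hj⟩ := (Nat.modEq_iff_dvd' hle).mp hdd
    exact ⟨j, by omega⟩
  obtain ⟨z, hz⟩ := (Nat.modEq_iff_dvd.mp hmod)
  push_cast at hz
  have hjZ : (d' : ℤ) = d + s * j := by exact_mod_cast hj
  obtain ⟨l, hl⟩ : (s : ℤ) ∣ m' - m := by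
    have h1 : (s : ℤ) ∣ (d : ℤ) ^ 2 * (m' - m) :=
      ⟨s * z - (2 * d * j + s * j ^ 2) * m', by rw [hjZ] at hz; linear_combination hz⟩
    exact (hcdZ.pow_right).dvd_of_dvd_mul_left h1
  have hlZ : (m' : ℤ) = m + s * l := by linarith
  have hlin : (s : ℤ) ∣ 2 * m * j + d * l := by
    have h1 : (s : ℤ) ∣ (d : ℤ) * (2 * m * j + d * l) := by
      have h2 : (s : ℤ) * (d * (2 * m * j + d * l)) =
          s * (s * (z - (j ^ 2 * m + 2 * d * j * l + s * j ^ 2 * l))) := by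
        rw [hjZ, hlZ] at hz
        linear_combination hz
      exact ⟨_, mul_left_cancel₀ (by exact_mod_cast hs.ne') h2⟩
    exact hcdZ.dvd_of_dvd_mul_left h1
  have hlR : (m' : ℝ) = m + s * l := by exact_mod_cast hlZ
  have hjR : (d' : ℝ) = d + s * j := by exact_mod_cast hj
  push_cast at hlow hclose
  rw [le_div_iff₀ (by positivity)] at hclose
  refine ⟨j, l, ?_, ?_, hj, hlZ, ?_⟩
  · rcases Nat.eq_zero_or_pos j with h0 | h
    · exfalso
      subst h0
      have hdd' : d' = d := by simpa using hj
      have hl0 : l ≠ 0 := by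
        rintro rfl
        apply hne
        have : m' = m := by exact_mod_cast (by simpa using hlZ : (m' : ℤ) = m)
        rw [hdd', this]
      have hsl : (s : ℤ) ∣ l := by
        have : (s : ℤ) ∣ d * l := by simpa using hlin
        exact hcdZ.dvd_of_dvd_mul_left this
      have h3 : (s : ℤ) ≤ |l| := Int.le_of_dvd (abs_pos.mpr hl0) ((dvd_abs _ _).mpr hsl)
      have h4 : (s : ℝ) ≤ |(l : ℝ)| := by exact_mod_cast h3
      have h5 : (d' : ℝ) ^ 2 * m' - d ^ 2 * m = d ^ 2 * (s * l) := by
        rw [hlR, hdd']; ring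
      rw [h5, abs_mul, abs_mul, abs_of_pos hsR, abs_of_nonneg (by positivity)] at hclose
      have h6 : D ^ 2 * (s * s) * s ^ 2 ≤ (d : ℝ) ^ 2 * (s * |(l : ℝ)|) * s ^ 2 := by gcongr
      nlinarith
    · exact h
  · rintro rfl
    have hjpos : 0 < j := by
      rcases Nat.eq_zero_or_pos j with h0 | h
      · exfalso
        subst h0
        apply hne
        have h1 : m' = m := by exact_mod_cast (by simpa using hlZ : (m' : ℤ) = m)
        have h2 : d' = d := by simpa using hj
        rw [h1, h2]
      · exact h
    have hsj : (s : ℤ) ∣ 2 * j := by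
      have : (s : ℤ) ∣ m * (2 * j) := by
        have h := hlin
        rw [mul_zero, add_zero] at h
        exact (by ring : (m : ℤ) * (2 * j) = 2 * m * j) ▸ h
      exact hcmZ.dvd_of_dvd_mul_left this
    have h3 : (s : ℤ) ≤ 2 * j := Int.le_of_dvd (by positivity) hsj
    have h4 : (s : ℝ) ≤ 2 * j := by exact_mod_cast h3
    have h5 : (d' : ℝ) ^ 2 * m' - d ^ 2 * m = m * (s * j) * (2 * d + s * j) := by
      rw [hlR, hjR]; simp; ring
    rw [h5, abs_of_nonneg (by positivity)] at hclose
    have hd0 : (0 : ℝ) < d := by linarith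
    have h6 : (m : ℝ) * (s * s) * d * s ^ 2 ≤ m * (s * j) * (2 * d + s * j) * s ^ 2 := by
      have h7 : (m : ℝ) * (s * s) * d ≤ m * (s * (2 * j)) * d := by gcongr
      have h8 : 0 ≤ (m : ℝ) * (s * j) * (s * j) := by positivity
      have h9 : (m : ℝ) * (s * s) * d ≤ m * (s * j) * (2 * d + s * j) := by linarith
      gcongr
    have hm0 : (0 : ℝ) < m := by
      rcases Nat.eq_zero_or_pos m with h0 | h
      · subst h0
        have : s = 1 := by simpa using hcm
        subst this
        norm_num at H1
        nlinarith
      · exact_mod_cast h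
    have h10 : (m * d : ℝ) * s ^ 4 ≤ (m * d : ℝ) * (β * d) := by nlinarith
    have h11 := le_of_mul_le_mul_left h10 (by positivity)
    nlinarith
  · obtain ⟨c, hc⟩ := hlin
    exact ⟨(d : ℤ) ^ 2 * c, by push_cast; linear_combination (d : ℤ) ^ 2 * hc⟩

theorem card_shift_index_le {s : ℕ} {D y β : ℝ} (hs : 0 < s) (hβ : 1 ≤ β) (hD : 1 ≤ D)
    (hy : 0 < y) (F : Finset ℕ) (d m : ℕ → ℕ) (hF : ∀ n ∈ F, n = d n ^ 2 * m n)
    (hd : ∀ n ∈ F, D ≤ d n ∧ d n ≤ 2 * D) (hlow : ∀ n ∈ F, y ≤ β * n)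
    (hclose : ∀ n ∈ F, ∀ n' ∈ F, |(n' : ℝ) - n| ≤ y / s ^ 2) (j : ℕ) (l : ℤ) (hj : 0 < j) :
    (((F.filter fun n => ∃ n' ∈ F, d n' = d n + s * j ∧ (m n' : ℤ) = m n + s * l).image
      fun n => ⌊(d n * s / D : ℝ)⌋₊).card : ℝ) ≤ 48 * β * D / (s ^ 2 * j) + 2 := by
  have hsR : (0 : ℝ) < s := by exact_mod_cast hs
  have hjR : (0 : ℝ) < j := by exact_mod_cast hj
  have hD0 : 0 < D := by linarith
  rw [show (48 * β * D / (s ^ 2 * j) + 2 : ℝ) = (48 * β * D / (s ^ 2 * j) + 1) + 1 by ring]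
  refine card_le_of_spread _ (by positivity) ?_
  intro a₁ ha₁ a₂ ha₂ hle
  obtain ⟨n₁, hn₁, rfl⟩ := Finset.mem_image.mp ha₁
  obtain ⟨n₂, hn₂, rfl⟩ := Finset.mem_image.mp ha₂
  obtain ⟨hn₁, n₁', hn₁', hd₁, hm₁⟩ := Finset.mem_filter.mp hn₁
  obtain ⟨hn₂, n₂', hn₂', hd₂, hm₂⟩ := Finset.mem_filter.mp hn₂
  rcases le_total (d n₂) (d n₁) with h | h
  · have h1 : ⌊(d n₂ * s / D : ℝ)⌋₊ ≤ ⌊(d n₁ * s / D : ℝ)⌋₊ := by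
      apply Nat.floor_le_floor
      gcongr
    have h2 : (⌊(d n₂ * s / D : ℝ)⌋₊ : ℝ) ≤ ⌊(d n₁ * s / D : ℝ)⌋₊ := by exact_mod_cast h1
    have : (0 : ℝ) ≤ 48 * β * D / (s ^ 2 * j) := by positivity
    linarith
  · have hR : (d n₁ : ℝ) ≤ d n₂ := by exact_mod_cast h
    have hcast (n : ℕ) (hn : n ∈ F) : (n : ℝ) = m n * (d n : ℝ) ^ 2 := by
      rw [mul_comm]; exact_mod_cast hF n hn
    have hdR₁ : (d n₁' : ℝ) = d n₁ + s * j := by exact_mod_cast hd₁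
    have hdR₂ : (d n₂' : ℝ) = d n₂ + s * j := by exact_mod_cast hd₂
    have hmR₁ : (m n₁' : ℝ) = m n₁ + s * l := by exact_mod_cast hm₁
    have hmR₂ : (m n₂' : ℝ) = m n₂ + s * l := by exact_mod_cast hm₂
    have hg := mul_gap_le (D := D) (d₁ := d n₁) (d₂ := d n₂) (δ := s * j) (m₁ := m n₁)
      (m₁' := m n₁') (m₂ := m n₂) (m₂' := m n₂') (t := y / s ^ 2) hD0 (by positivity)
      (hd n₁ hn₁).1 hR (by rw [← hdR₂]; exact (hd n₂' hn₂').2)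
      (by rw [← hdR₁, ← hcast _ hn₁', ← hcast _ hn₁]; exact hclose _ hn₁ _ hn₁')
      (by rw [← hcast _ hn₂, ← hcast _ hn₁]; exact hclose _ hn₁ _ hn₂)
      (by rw [← hdR₂, ← hcast _ hn₂', ← hcast _ hn₁]; exact hclose _ hn₁ _ hn₂')
      (by rw [hmR₁, hmR₂]; ring) (by positivity)
    rw [← hcast _ hn₁] at hg
    have hgap : (d n₂ - d n₁ : ℝ) * s / D ≤ 48 * β * D / (s ^ 2 * j) := by
      rw [div_le_div_iff₀ hD0 (by positivity)]
      have h1 : y * (s * j * (d n₂ - d n₁ : ℝ)) ≤ β * (48 * (y / s ^ 2) * D ^ 2) :=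
        calc y * (s * j * (d n₂ - d n₁ : ℝ)) ≤ β * n₁ * (s * j * (d n₂ - d n₁ : ℝ)) := by
              have h2 : 0 ≤ (d n₂ - d n₁ : ℝ) := by linarith
              have h3 := hlow _ hn₁
              gcongr
          _ = β * (n₁ * (s * j * (d n₂ - d n₁ : ℝ))) := by ring
          _ ≤ _ := by gcongr
      have h2 : β * (48 * (y / s ^ 2) * D ^ 2) = y * (48 * β * D ^ 2 / s ^ 2) := by ring
      rw [h2] at h1
      have h3 := le_of_mul_le_mul_left h1 hy
      rw [le_div_iff₀ (by positivity)] at h3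
      linarith
    have h1 := Nat.floor_le (by positivity : (0 : ℝ) ≤ d n₂ * s / D)
    have h2 := Nat.lt_floor_add_one (d n₁ * s / D : ℝ)
    have h3 : (d n₂ - d n₁ : ℝ) * s / D = d n₂ * s / D - d n₁ * s / D := by ring
    linarith

/-- A residue class modulo `s²` in a short interval contains few multiples of squares `d²` with
`D ≤ d ≤ 2D`. -/
theorem card_square_multiples_le {s : ℕ} {D y β : ℝ} (hs : 0 < s) (hβ : 1 ≤ β) (hD : 1 ≤ D)
    (hy : 0 < y) (F : Finset ℕ) (d m : ℕ → ℕ) (hF : ∀ n ∈ F, n = d n ^ 2 * m n)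
    (hd : ∀ n ∈ F, D ≤ d n ∧ d n ≤ 2 * D) (hcop : ∀ n ∈ F, n.Coprime s)
    (hlow : ∀ n ∈ F, y ≤ β * n) (hup : ∀ n ∈ F, (n : ℝ) ≤ y)
    (hmod : ∀ n ∈ F, ∀ n' ∈ F, n ≡ n' [MOD s ^ 2])
    (hclose : ∀ n ∈ F, ∀ n' ∈ F, |(n' : ℝ) - n| ≤ y / s ^ 2)
    (H1 : 2 * β * D < s ^ 4) (H2 : y < s ^ 4 * D ^ 2) (H3 : y ≤ D * s ^ 6) :
    (F.card : ℝ) ≤ 502 * β * 3 ^ s.primeFactors.card * s.divisors.card * s ^ 2 := by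
  classical
  rcases F.eq_empty_or_nonempty with rfl | ⟨n₀, hn₀⟩
  · simp; positivity
  have hsR : (0 : ℝ) < s := by exact_mod_cast hs
  have hs1 : (1 : ℝ) ≤ s := by exact_mod_cast hs
  have hD0 : 0 < D := by linarith
  let cell : ℕ → ℕ × ℕ := fun n => (d n % s, ⌊(d n * s / D : ℝ)⌋₊)
  set G := F.image cell with hG
  have hGcard : G.card ≤ s * (s + 1) := by
    have hsub : G ⊆ Finset.range s ×ˢ Finset.Icc s (2 * s) := by
      intro c hc
      obtain ⟨n, hn, rfl⟩ := Finset.mem_image.mp hc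
      refine Finset.mem_product.mpr ⟨Finset.mem_range.mpr (Nat.mod_lt _ hs),
        Finset.mem_Icc.mpr ⟨?_, ?_⟩⟩
      · apply Nat.le_floor
        rw [le_div_iff₀ hD0, mul_comm]
        exact mul_le_mul_of_nonneg_right (hd n hn).1 hsR.le
      · apply Nat.floor_le_of_le
        rw [div_le_iff₀ hD0]
        push_cast
        nlinarith [(hd n hn).2]
    refine (Finset.card_le_card hsub).trans ?_
    rw [Finset.card_product, Finset.card_range, Nat.card_Icc]
    exact Nat.mul_le_mul_left _ (by omega)
  have hbase : ∀ c : ℕ × ℕ, ∃ n, c ∈ G → n ∈ F ∧ cell n = c ∧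
      ∀ n' ∈ F, cell n' = c → d n ≤ d n' := by
    intro c
    by_cases hc : c ∈ G
    · obtain ⟨n, hn, hnc⟩ := Finset.mem_image.mp hc
      obtain ⟨u, hu, hmin⟩ := Finset.exists_min_image (F.filter fun n => cell n = c) d
        ⟨n, Finset.mem_filter.mpr ⟨hn, hnc⟩⟩
      rw [Finset.mem_filter] at hu
      exact ⟨u, fun _ => ⟨hu.1, hu.2, fun n' hn' hc' =>
        hmin n' (Finset.mem_filter.mpr ⟨hn', hc'⟩)⟩⟩
    · exact ⟨0, fun h => absurd h hc⟩
  choose base hbase using hbase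
  set J := ⌊D / s ^ 2⌋₊ with hJ
  let Y : ℕ → ℝ := fun j => y / (s ^ 3 * D ^ 2) + 2 * y * j / D ^ 3
  let Ls : ℕ → Finset ℤ := fun j => (Finset.Icc (-(⌊Y j⌋₊ : ℤ)) ⌊Y j⌋₊).erase 0
  let R : ℕ → ℤ → Finset ℕ := fun j l => (Finset.range s).filter
    (fun r : ℕ => r.Coprime s ∧ (s : ℤ) ∣ 2 * j * n₀ + (r : ℤ) ^ 3 * l)
  let A : ℕ → ℤ → Finset ℕ := fun j l =>
    (F.filter fun n => ∃ n' ∈ F, d n' = d n + s * j ∧ (m n' : ℤ) = m n + s * l).image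
      fun n => ⌊(d n * s / D : ℝ)⌋₊
  let T : Finset (Σ _ : ℕ, Σ _ : ℤ, ℕ × ℕ) :=
    (Finset.Icc 1 J).sigma fun j => (Ls j).sigma fun l => R j l ×ˢ A j l
  have hshift : ∀ n ∈ F \ G.image base, ∃ j : ℕ, ∃ l : ℤ,
      d n = d (base (cell n)) + s * j ∧ (m n : ℤ) = m (base (cell n)) + s * l ∧
      (⟨j, l, cell n⟩ : Σ _ : ℕ, Σ _ : ℤ, ℕ × ℕ) ∈ T := by
    intro n hn
    obtain ⟨hnF, hnb⟩ := Finset.mem_sdiff.mp hn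
    have hcG : cell n ∈ G := Finset.mem_image_of_mem _ hnF
    obtain ⟨huF, huc, humin⟩ := hbase _ hcG
    have hne : base (cell n) ≠ n := fun h => hnb (h ▸ Finset.mem_image_of_mem base hcG)
    set u := base (cell n) with hu
    have hdmod : d u ≡ d n [MOD s] := congrArg Prod.fst huc
    have hfl : ⌊(d u * s / D : ℝ)⌋₊ = ⌊(d n * s / D : ℝ)⌋₊ := congrArg Prod.snd huc
    have hle := humin n hnF rfl
    have hFu := hF u huF
    have hFn := hF n hnF
    obtain ⟨j, l, hj, hl, hdj, hml, hdiv⟩ := exists_shift_of_near (s := s) (d := d u) (d' := d n)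
      (m := m u) (m' := m n) (D := D) (y := y) (β := β) hs hβ hD (hFu ▸ hcop u huF)
      (by rw [← hFu, ← hFn]; exact hmod u huF n hnF) hdmod hle
      (by rw [← hFu, ← hFn]; exact hne) (hd u huF).1 (hd u huF).2
      (by rw [← hFu]; exact hlow u huF)
      (by rw [← hFu, ← hFn]; exact hclose u huF n hnF) H1 H2
    rw [← hFu] at hdiv
    have hdjR : (d n : ℝ) = d u + s * j := by exact_mod_cast hdj
    have hmlR : (m n : ℝ) = m u + s * l := by exact_mod_cast hml
    have hcastu : (u : ℝ) = m u * (d u : ℝ) ^ 2 := by rw [mul_comm]; exact_mod_cast hFu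
    have hcastn : (n : ℝ) = m n * (d n : ℝ) ^ 2 := by rw [mul_comm]; exact_mod_cast hFn
    refine ⟨j, l, hdj, hml, ?_⟩
    refine Finset.mem_sigma.mpr ⟨Finset.mem_Icc.mpr ⟨hj, ?_⟩,
      Finset.mem_sigma.mpr ⟨?_, Finset.mem_product.mpr ⟨?_, ?_⟩⟩⟩
    · apply Nat.le_floor
      have h1 := Nat.floor_le (by positivity : (0 : ℝ) ≤ d u * s / D)
      have h2 := Nat.lt_floor_add_one (d n * s / D : ℝ)
      rw [← hfl] at h2
      have h3 : (d n * s / D : ℝ) = d u * s / D + s ^ 2 * j / D := by rw [hdjR]; ring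
      have h4 : (s ^ 2 * j / D : ℝ) < 1 := by linarith
      rw [div_lt_one hD0] at h4
      rw [le_div_iff₀ (by positivity)]
      change (j : ℝ) * s ^ 2 ≤ D
      linarith
    · have h1 := abs_sub_le_of_near_curve (D := D) (y := y) (d := d u) (δ := s * j) (m := m u)
        (m' := m n) (t := y / s ^ 2) hD0 (by positivity) (hd u huF).1 (by positivity)
        (by rw [← hcastu]; exact hup u huF)
        (by rw [← hdjR, ← hcastu, ← hcastn]; exact hclose u huF n hnF)
      have h2 : (m n : ℝ) - m u = s * l := by linarith
      rw [h2, abs_mul, abs_of_pos hsR] at h1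
      have h3 : |(l : ℝ)| ≤ Y j := by
        have h4 : y / s ^ 2 / D ^ 2 + 2 * y * (s * j) / D ^ 3 = s * Y j := by
          simp only [Y]
          field_simp
        rw [h4] at h1
        exact le_of_mul_le_mul_left h1 hsR
      have h5 : l.natAbs ≤ ⌊Y j⌋₊ := by
        apply Nat.le_floor
        rw [Nat.cast_natAbs, Int.cast_abs]
        exact h3
      have h6 : -(⌊Y j⌋₊ : ℤ) ≤ l ∧ l ≤ ⌊Y j⌋₊ := by omega
      exact Finset.mem_erase.mpr ⟨hl, Finset.mem_Icc.mpr h6⟩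
    · refine Finset.mem_filter.mpr ⟨Finset.mem_range.mpr (Nat.mod_lt _ hs), ?_, ?_⟩
      · have hdn : d n ∣ n := ⟨d n * m n, hFn.trans (by ring)⟩
        have : (d n).Coprime s := Nat.Coprime.coprime_dvd_left hdn (hcop n hnF)
        change Nat.gcd (d n % s) s = 1
        rw [← Nat.gcd_rec, Nat.gcd_comm]
        exact this
      · have e1 : ((d n % s : ℕ) : ℤ) ≡ d u [ZMOD s] :=
          (Int.natCast_modEq_iff.mpr (((Nat.mod_modEq _ _).trans hdmod.symm)))
        have e2 : (n₀ : ℤ) ≡ u [ZMOD s] := Int.natCast_modEq_iff.mpr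
          ((hmod n₀ hn₀ u huF).of_dvd (Dvd.intro_left (s ^ 1) (by ring)))
        have e3 := ((e2.mul_left (2 * (j : ℤ))).add ((e1.pow 3).mul_right l))
        exact (Int.modEq_zero_iff_dvd.mp (e3.trans (Int.modEq_zero_iff_dvd.mpr hdiv)))
    · refine Finset.mem_image.mpr ⟨u, Finset.mem_filter.mpr ⟨huF, n, hnF, hdj, hml⟩, hfl⟩
  have hTcard : (F \ G.image base).card ≤ T.card := by
    choose! jf lf hdf hmf hTf using hshift
    refine Finset.card_le_card_of_injOn
      (fun n => (⟨jf n, lf n, cell n⟩ : Σ _ : ℕ, Σ _ : ℤ, ℕ × ℕ)) (fun n hn => hTf n hn) ?_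
    intro n hn n' hn' h
    simp only [Sigma.mk.injEq, heq_eq_eq] at h
    obtain ⟨h1, h2, h3⟩ := h
    have e1 := hdf n hn
    have e2 := hmf n hn
    rw [h1, h3, ← hdf n' hn'] at e1
    rw [h2, h3, ← hmf n' hn'] at e2
    rw [hF n (Finset.mem_sdiff.mp hn).1, hF n' (Finset.mem_sdiff.mp hn').1, e1,
      Int.natCast_inj.mp e2]
  obtain ⟨K, hK⟩ : ∃ K : ℝ, K = 3 ^ s.primeFactors.card := ⟨_, rfl⟩
  obtain ⟨τ, hτ⟩ : ∃ τ : ℝ, τ = s.divisors.card := ⟨_, rfl⟩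
  rw [← hK, ← hτ]
  have hK1 : 1 ≤ K := hK ▸ one_le_pow₀ (by norm_num)
  have hτ1 : 1 ≤ τ := by
    have : 0 < s.divisors.card := Finset.card_pos.mpr ⟨1, Nat.one_mem_divisors.mpr hs.ne'⟩
    rw [hτ]
    exact_mod_cast this
  have hinner : ∀ j ∈ Finset.Icc 1 J,
      ((((Ls j).sigma fun l => R j l ×ˢ A j l).card : ℕ) : ℝ) ≤
        100 * β * K * τ * (s / j + 2 * s ^ 4 / D) := by
    intro j hj
    rw [Finset.mem_Icc] at hj
    have hjR : (0 : ℝ) < j := by exact_mod_cast hj.1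
    have hjJ : (j : ℝ) ≤ D / s ^ 2 :=
      (Nat.cast_le.mpr hj.2).trans (Nat.floor_le (by positivity))
    have hjD : (1 : ℝ) ≤ D / (s ^ 2 * j) := by
      rw [le_div_iff₀ (by positivity)] at hjJ ⊢
      linarith
    rw [Finset.card_sigma]
    push_cast
    calc ∑ l ∈ Ls j, ((R j l ×ˢ A j l).card : ℝ)
        ≤ ∑ l ∈ Ls j, K * (Int.gcd l s : ℝ) * (50 * β * (D / (s ^ 2 * j))) := by
          refine Finset.sum_le_sum fun l _ => ?_
          rw [Finset.card_product, Nat.cast_mul]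
          refine mul_le_mul ?_ ?_ (Nat.cast_nonneg _) (by positivity)
          · rw [hK]
            exact_mod_cast card_cubic_congruence_le s hs (2 * j * n₀) l
          · refine (card_shift_index_le hs hβ hD hy F d m hF hd hlow hclose j l hj.1).trans ?_
            have : (48 * β * D / (s ^ 2 * j) : ℝ) = 48 * β * (D / (s ^ 2 * j)) := by ring
            rw [this]
            nlinarith
      _ = K * (50 * β * (D / (s ^ 2 * j))) * ((∑ l ∈ Ls j, Int.gcd l s : ℕ) : ℝ) := by
          push_cast
          rw [Finset.mul_sum]
          exact Finset.sum_congr rfl fun l _ => by ring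
      _ ≤ K * (50 * β * (D / (s ^ 2 * j))) * (2 * (τ * Y j)) := by
          refine mul_le_mul_of_nonneg_left ?_ (by positivity)
          have h1 := sum_int_gcd_le s ⌊Y j⌋₊ hs
          have h2 : ((∑ l ∈ Ls j, Int.gcd l s : ℕ) : ℝ) ≤
              ((2 * (s.divisors.card * ⌊Y j⌋₊) : ℕ) : ℝ) := by exact_mod_cast h1
          refine h2.trans ?_
          push_cast
          rw [← hτ]
          have h3 : (⌊Y j⌋₊ : ℝ) ≤ Y j := Nat.floor_le (by positivity)
          gcongr
      _ = 100 * β * K * τ * (y / (D * s ^ 6) * (s / j + 2 * s ^ 4 / D)) := by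
          simp only [Y]
          field_simp
          ring
      _ ≤ 100 * β * K * τ * (1 * (s / j + 2 * s ^ 4 / D)) := by
          have : y / (D * s ^ 6) ≤ 1 := by rw [div_le_one (by positivity)]; exact H3
          gcongr
      _ = _ := by ring
  have hJD : (J : ℝ) ≤ D / s ^ 2 := Nat.floor_le (by positivity)
  have hharm : ∑ j ∈ Finset.Icc 1 J, (1 / j : ℝ) ≤ 1 + 2 * s := by
    rcases Nat.eq_zero_or_pos J with h0 | hJ0
    · rw [h0]; simp; positivity
    have h1 := harmonic_le_one_add_log J
    rw [harmonic_eq_sum_Icc] at h1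
    push_cast at h1
    simp only [one_div]
    refine h1.trans ?_
    have h2 : (J : ℝ) ≤ s ^ 2 := by
      refine hJD.trans ?_
      rw [div_le_iff₀ (by positivity)]
      nlinarith
    have h3 := Real.log_le_log (by exact_mod_cast hJ0) h2
    rw [Real.log_pow] at h3
    have h4 := Real.log_le_sub_one_of_pos hsR
    push_cast at h3
    linarith
  have hT : (T.card : ℝ) ≤ 500 * β * K * τ * s ^ 2 := by
    rw [Finset.card_sigma]
    push_cast
    calc ∑ j ∈ Finset.Icc 1 J, ((((Ls j).sigma fun l => R j l ×ˢ A j l).card : ℕ) : ℝ)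
        ≤ ∑ j ∈ Finset.Icc 1 J, 100 * β * K * τ * (s / j + 2 * s ^ 4 / D) :=
          Finset.sum_le_sum hinner
      _ = 100 * β * K * τ * (s * ∑ j ∈ Finset.Icc 1 J, (1 / j : ℝ) + J * (2 * s ^ 4 / D)) := by
          rw [← Finset.mul_sum, Finset.sum_add_distrib, Finset.mul_sum]
          congr 2
          · exact Finset.sum_congr rfl fun j _ => by ring
          · simp
      _ ≤ 100 * β * K * τ * (s * (1 + 2 * s) + D / s ^ 2 * (2 * s ^ 4 / D)) := by gcongr
      _ = 100 * β * K * τ * (s + 4 * s ^ 2) := by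
          field_simp
          ring
      _ ≤ 100 * β * K * τ * (5 * s ^ 2) := by
          gcongr
          nlinarith
      _ = _ := by ring
  have hFcard : F.card ≤ (F \ G.image base).card + G.card := by
    have h1 := Finset.card_le_card_sdiff_add_card (s := F) (t := G.image base)
    exact h1.trans (Nat.add_le_add_left Finset.card_image_le _)
  have h1 : (F.card : ℝ) ≤ T.card + s * (s + 1) := by
    exact_mod_cast hFcard.trans (Nat.add_le_add hTcard hGcard)
  have h2 : (s * (s + 1) : ℝ) ≤ 2 * β * K * τ * s ^ 2 := by
    have h3 : (1 : ℝ) ≤ β * K * τ := one_le_mul_of_one_le_of_one_le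
      (one_le_mul_of_one_le_of_one_le hβ hK1) hτ1
    nlinarith
  linarith

theorem modEq_of_palindrome {b N k n n' : ℕ} (hb : 1 < b)
    (hp : (Nat.digits b n).Palindrome) (hp' : (Nat.digits b n').Palindrome)
    (hN : (Nat.digits b n).length = N) (hN' : (Nat.digits b n').length = N)
    (htop : n / b ^ (N - k) = n' / b ^ (N - k)) : n ≡ n' [MOD b ^ k] := by
  have key (u : ℕ) (hu : (Nat.digits b u).Palindrome) (huN : (Nat.digits b u).length = N) :
      (Nat.digits b u).take k = ((Nat.digits b u).drop (N - k)).reverse := by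
    conv_lhs => rw [← hu.reverse_eq]
    rw [List.take_reverse, huN]
  rw [Nat.self_div_pow_eq_ofDigits_drop _ _ hb, Nat.self_div_pow_eq_ofDigits_drop _ _ hb] at htop
  have hdrop := Nat.ofDigits_inj_of_len_eq hb (by simp [hN, hN'])
    (fun l hl => Nat.digits_lt_base hb (List.mem_of_mem_drop hl))
    (fun l hl => Nat.digits_lt_base hb (List.mem_of_mem_drop hl)) htop
  rw [Nat.ModEq, Nat.self_mod_pow_eq_ofDigits_take _ _ hb,
    Nat.self_mod_pow_eq_ofDigits_take _ _ hb, key n hp hN, key n' hp' hN', hdrop]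

theorem card_palindrome_square_multiples_le {b k : ℕ} (hb : 2 ≤ b) {x D : ℝ}
    (hD : 1 ≤ D) (S : Finset ℕ)
    (hS : ∀ n ∈ S, 0 < n ∧ (n : ℝ) ≤ x ∧ (Nat.digits b n).Palindrome ∧ n.Coprime b ∧
      ∃ d : ℕ, D ≤ d ∧ (d : ℝ) ≤ 2 * D ∧ d ^ 2 ∣ n)
    (H1 : 2 * b * D < ((b ^ k : ℕ) : ℝ) ^ 4) (H2 : b * x < ((b ^ k : ℕ) : ℝ) ^ 4 * D ^ 2)
    (H3 : b * x ≤ D * ((b ^ k : ℕ) : ℝ) ^ 6) :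
    (S.card : ℝ) ≤ 503 * b * 3 ^ (b ^ k).primeFactors.card * (b ^ k).divisors.card *
      (Nat.log b ⌊x⌋₊ + 2 : ℕ) * ((b ^ k : ℕ) : ℝ) ^ 4 := by
  classical
  have hb1 : 1 < b := hb
  have hbR : (1 : ℝ) ≤ b := by exact_mod_cast hb1.le
  set s := b ^ k with hs
  have hspos : 0 < s := Nat.pow_pos (by omega)
  have hsR : (1 : ℝ) ≤ s := by exact_mod_cast hspos
  have hs2 : s ^ 2 = b ^ (2 * k) := by rw [hs, ← pow_mul, mul_comm]
  set B : ℝ := 502 * b * 3 ^ s.primeFactors.card * s.divisors.card * s ^ 2 with hB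
  set len : ℕ → ℕ := fun n => (Nat.digits b n).length with hlen
  set f : ℕ → ℕ × ℕ := fun n => (len n, n / b ^ (len n - 2 * k)) with hf
  set S₁ := S.filter (fun n => 2 * k ≤ len n) with hS₁
  have hsmall : (S.filter (fun n => ¬ 2 * k ≤ len n)).card ≤ s ^ 2 := by
    refine (Finset.card_le_card (t := Finset.range (s ^ 2)) fun n hn => ?_).trans (by simp)
    have h1 := (Finset.mem_filter.mp hn).2
    rw [Finset.mem_range, hs2]
    exact (Nat.lt_base_pow_length_digits hb1).trans_le
      (Nat.pow_le_pow_right (by omega) (not_le.mp h1).le)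
  have himage : (S₁.image f).card ≤ (Nat.log b ⌊x⌋₊ + 2) * s ^ 2 := by
    have hsub : S₁.image f ⊆ Finset.range (Nat.log b ⌊x⌋₊ + 2) ×ˢ Finset.range (s ^ 2) := by
      intro c hc
      obtain ⟨n, hn, rfl⟩ := Finset.mem_image.mp hc
      obtain ⟨hnS, hnk⟩ := Finset.mem_filter.mp hn
      obtain ⟨hn0, hnx, -⟩ := hS n hnS
      refine Finset.mem_product.mpr ⟨Finset.mem_range.mpr ?_, Finset.mem_range.mpr ?_⟩
      · change (Nat.digits b n).length < _
        rw [Nat.length_digits b n hb1 hn0.ne']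
        have := Nat.log_mono_right (b := b) (Nat.le_floor hnx)
        omega
      · change n / b ^ (len n - 2 * k) < _
        rw [Nat.div_lt_iff_lt_mul (Nat.pow_pos (by omega)), hs2, ← pow_add,
          Nat.add_sub_cancel' hnk]
        exact Nat.lt_base_pow_length_digits hb1
    refine (Finset.card_le_card hsub).trans ?_
    rw [Finset.card_product, Finset.card_range, Finset.card_range]
  have hd : ∀ n, ∃ d m : ℕ, n ∈ S → D ≤ d ∧ (d : ℝ) ≤ 2 * D ∧ n = d ^ 2 * m := by
    intro n
    by_cases hn : n ∈ S
    · obtain ⟨-, -, -, -, d, h1, h2, m, h3⟩ := hS n hn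
      exact ⟨d, m, fun _ => ⟨h1, h2, h3⟩⟩
    · exact ⟨0, 0, fun h => absurd h hn⟩
  choose d m hdm using hd
  have hfibre : ∀ c ∈ S₁.image f, (S₁.filter fun n => f n = c).card ≤ ⌊B⌋₊ := by
    intro c hc
    obtain ⟨n₁, hn₁, rfl⟩ := Finset.mem_image.mp hc
    obtain ⟨hn₁S, hn₁k⟩ := Finset.mem_filter.mp hn₁
    set N := len n₁ with hN
    have hF : ∀ n ∈ S₁.filter (fun n => f n = f n₁), n ∈ S ∧ len n = N ∧
        n / b ^ (N - 2 * k) = n₁ / b ^ (N - 2 * k) := by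
      intro n hn
      obtain ⟨hn, hfn⟩ := Finset.mem_filter.mp hn
      have h1 : len n = N := congrArg Prod.fst hfn
      have h2 : n / b ^ (len n - 2 * k) = n₁ / b ^ (N - 2 * k) := congrArg Prod.snd hfn
      rw [h1] at h2
      exact ⟨(Finset.mem_filter.mp hn).1, h1, h2⟩
    have hpow : ∀ n, n ≠ 0 → len n = N → ((b ^ N : ℕ) : ℝ) ≤ b * n := by
      intro n hn h
      have := Nat.base_pow_length_digits_le b n hb1 hn
      rw [← h]
      exact_mod_cast this
    have hyx : ((b ^ N : ℕ) : ℝ) ≤ b * x :=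
      (hpow n₁ (hS n₁ hn₁S).1.ne' rfl).trans
        (mul_le_mul_of_nonneg_left (hS n₁ hn₁S).2.1 (by positivity))
    have hbN : ((b ^ N : ℕ) : ℝ) / s ^ 2 = ((b ^ (N - 2 * k) : ℕ) : ℝ) := by
      rw [div_eq_iff (by positivity)]
      have : b ^ N = b ^ (N - 2 * k) * s ^ 2 := by
        rw [hs2, ← pow_add, Nat.sub_add_cancel hn₁k]
      exact_mod_cast this
    apply Nat.le_floor
    refine card_square_multiples_le (D := D) (y := ((b ^ N : ℕ) : ℝ)) (β := b) hspos hbR hD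
      (by positivity) _ d m (fun n hn => (hdm n (hF n hn).1).2.2)
      (fun n hn => ⟨(hdm n (hF n hn).1).1, (hdm n (hF n hn).1).2.1⟩)
      (fun n hn => Nat.Coprime.pow_right _ (hS n (hF n hn).1).2.2.2.1)
      (fun n hn => hpow n (hS n (hF n hn).1).1.ne' (hF n hn).2.1) ?_ ?_ ?_ H1
      (hyx.trans_lt H2) (hyx.trans H3)
    · intro n hn
      have h1 : n < b ^ len n := Nat.lt_base_pow_length_digits hb1
      rw [(hF n hn).2.1] at h1
      exact_mod_cast h1.le
    · intro n hn n' hn'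
      rw [hs2]
      exact modEq_of_palindrome hb1 (hS n (hF n hn).1).2.2.1 (hS n' (hF n' hn').1).2.2.1
        (hF n hn).2.1 (hF n' hn').2.1 ((hF n hn).2.2.trans (hF n' hn').2.2.symm)
    · intro n hn n' hn'
      rw [hbN]
      have hq : 0 < b ^ (N - 2 * k) := Nat.pow_pos (by omega)
      have e := (hF n hn).2.2.trans (hF n' hn').2.2.symm
      have h1 := Nat.div_add_mod n (b ^ (N - 2 * k))
      have h2 := Nat.div_add_mod n' (b ^ (N - 2 * k))
      have h3 := Nat.mod_lt n hq
      have h4 := Nat.mod_lt n' hq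
      rw [e] at h1
      generalize b ^ (N - 2 * k) * (n' / b ^ (N - 2 * k)) = z at h1 h2
      have h5 : n' ≤ n + b ^ (N - 2 * k) := by linarith [Nat.zero_le (n % b ^ (N - 2 * k))]
      have h6 : n ≤ n' + b ^ (N - 2 * k) := by linarith [Nat.zero_le (n' % b ^ (N - 2 * k))]
      have h5' : (n' : ℝ) ≤ n + (b ^ (N - 2 * k) : ℕ) := by exact_mod_cast h5
      have h6' : (n : ℝ) ≤ n' + (b ^ (N - 2 * k) : ℕ) := by exact_mod_cast h6
      rw [abs_le]
      constructor <;> linarith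
  have hcard := Finset.card_le_mul_card_image S₁ ⌊B⌋₊ hfibre
  have htot : S.card ≤ ⌊B⌋₊ * ((Nat.log b ⌊x⌋₊ + 2) * s ^ 2) + s ^ 2 := by
    rw [← Finset.card_filter_add_card_filter_not (s := S) (fun n => 2 * k ≤ len n)]
    exact Nat.add_le_add (hcard.trans (Nat.mul_le_mul_left _ himage)) hsmall
  have hBfl : (⌊B⌋₊ : ℝ) ≤ B := Nat.floor_le (by positivity)
  obtain ⟨ℓ, hℓ⟩ : ∃ ℓ : ℕ, ℓ = Nat.log b ⌊x⌋₊ + 2 := ⟨_, rfl⟩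
  rw [← hℓ] at htot ⊢
  have hℓ1 : (1 : ℝ) ≤ ℓ := by
    have : 1 ≤ ℓ := by omega
    exact_mod_cast this
  have hτ1 : (1 : ℝ) ≤ s.divisors.card := by
    have : 0 < s.divisors.card := Finset.card_pos.mpr ⟨1, Nat.one_mem_divisors.mpr hspos.ne'⟩
    exact_mod_cast this
  have hK1 : (1 : ℝ) ≤ 3 ^ s.primeFactors.card := one_le_pow₀ (by norm_num)
  obtain ⟨P, hP⟩ : ∃ P : ℝ, P = b * 3 ^ s.primeFactors.card * s.divisors.card * ℓ := ⟨_, rfl⟩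
  have hP1 : 1 ≤ P := hP ▸ one_le_mul_of_one_le_of_one_le (one_le_mul_of_one_le_of_one_le
    (one_le_mul_of_one_le_of_one_le hbR hK1) hτ1) hℓ1
  calc (S.card : ℝ) ≤ ⌊B⌋₊ * (ℓ * s ^ 2) + s ^ 2 := by exact_mod_cast htot
    _ ≤ B * (ℓ * s ^ 2) + s ^ 2 := by gcongr
    _ = 502 * P * s ^ 4 + 1 * s ^ 2 := by rw [hB, hP]; ring
    _ ≤ 502 * P * s ^ 4 + P * s ^ 4 := by
      gcongr
      norm_num
    _ = _ := by rw [hP]; ring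

theorem exists_pow_mul_le_rpow (b : ℕ) {ε : ℝ} (hε : 0 < ε) :
    ∃ C : ℝ, 0 < C ∧ ∀ x : ℝ, 1 ≤ x → ∀ u v : ℝ, 0 ≤ u → 0 ≤ v → u ≤ 2 + 2 * Real.log x →
      v ≤ 2 + 2 * Real.log x → (b * u + 1) ^ b * v ≤ C * x ^ ε := by
  set η : ℝ := ε / (b + 1 : ℕ) with hη
  have hη0 : 0 < η := by positivity
  refine ⟨2 * (2 * b + 1) ^ b * (1 + 1 / η) ^ (b + 1), by positivity,
    fun x hx u v hu hv hux hvx => ?_⟩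
  have hlog : 0 ≤ Real.log x := Real.log_nonneg hx
  have hxη : 1 ≤ x ^ η := Real.one_le_rpow hx hη0.le
  have hL : 1 + Real.log x ≤ (1 + 1 / η) * x ^ η := by
    have := Real.log_le_rpow_div (zero_le_one.trans hx) hη0
    calc 1 + Real.log x ≤ x ^ η + x ^ η / η := by linarith
      _ = _ := by ring
  have hu' : b * u + 1 ≤ (2 * b + 1) * (1 + Real.log x) := by
    have : (b : ℝ) * u ≤ b * (2 + 2 * Real.log x) := by gcongr
    linarith
  calc (b * u + 1) ^ b * v
      ≤ ((2 * b + 1) * (1 + Real.log x)) ^ b * (2 * (1 + Real.log x)) := by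
        gcongr
        linarith
    _ = 2 * (2 * b + 1) ^ b * (1 + Real.log x) ^ (b + 1) := by rw [mul_pow]; ring
    _ ≤ 2 * (2 * b + 1) ^ b * ((1 + 1 / η) * x ^ η) ^ (b + 1) := by gcongr
    _ = 2 * (2 * b + 1) ^ b * (1 + 1 / η) ^ (b + 1) * (x ^ η) ^ (b + 1) := by
        rw [mul_pow _ (x ^ η)]; ring
    _ = 2 * (2 * b + 1) ^ b * (1 + 1 / η) ^ (b + 1) * x ^ ε := by
        rw [← Real.rpow_mul_natCast (zero_le_one.trans hx), hη,
          div_mul_cancel₀ _ (by positivity)]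

theorem natLog_floor_le {b : ℕ} (hb : 2 ≤ b) {x : ℝ} (hx : 1 ≤ x) :
    (Nat.log b ⌊x⌋₊ : ℝ) ≤ 2 * Real.log x := by
  have h1 : ((b ^ Nat.log b ⌊x⌋₊ : ℕ) : ℝ) ≤ x :=
    (Nat.cast_le.mpr (Nat.pow_log_le_self b (Nat.floor_pos.mpr hx).ne')).trans
      (Nat.floor_le (zero_le_one.trans hx))
  have h2 : (2 : ℝ) ^ Nat.log b ⌊x⌋₊ ≤ x := by
    refine le_trans ?_ h1
    push_cast
    gcongr
    exact_mod_cast hb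
  have h3 := Real.log_le_log (by positivity) h2
  rw [Real.log_pow] at h3
  nlinarith [Real.log_two_gt_d9, Nat.cast_nonneg (α := ℝ) (Nat.log b ⌊x⌋₊)]

theorem exists_balancing_exponent {b : ℕ} (hb : 2 ≤ b) {x D : ℝ} (hD : 1 ≤ D)
    (hxD : x ≤ D ^ 4) (hDx : D ^ 5 ≤ x ^ 2) (hx : 1 ≤ x) :
    ∃ k : ℕ, k ≠ 0 ∧ (k : ℝ) ≤ 2 + 2 * Real.log x ∧
      2 * b * D < ((b ^ k : ℕ) : ℝ) ^ 4 ∧ b * x < ((b ^ k : ℕ) : ℝ) ^ 4 * D ^ 2 ∧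
      b * x ≤ D * ((b ^ k : ℕ) : ℝ) ^ 6 ∧
      ((b ^ k : ℕ) : ℝ) ^ 4 ≤ 4 * b ^ 6 * (x / D) ^ ((2 : ℝ) / 3) := by
  have hbR : (2 : ℝ) ≤ b := by exact_mod_cast hb
  have hx0 : 0 < x := zero_lt_one.trans_le hx
  have hD0 : 0 < D := zero_lt_one.trans_le hD
  have hDlex : D ≤ x := by
    refine le_of_pow_le_pow_left₀ (n := 5) (by norm_num) hx0.le (hDx.trans ?_)
    exact pow_le_pow_right₀ hx (by norm_num)
  have hw : 1 ≤ 8 * b ^ 3 * (x / D) :=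
    one_le_mul_of_one_le_of_one_le
      (one_le_mul_of_one_le_of_one_le (by norm_num) (one_le_pow₀ (by linarith)))
      ((one_le_div hD0).mpr hDlex)
  have hb6 : (2 : ℝ) ^ 6 ≤ (b : ℝ) ^ 6 := by gcongr
  obtain ⟨n, hn1, hn2⟩ := exists_nat_pow_near hw (y := (b : ℝ) ^ 6) (by linarith)
  obtain ⟨s, hs⟩ : ∃ s : ℝ, s = ((b ^ (n + 1) : ℕ) : ℝ) := ⟨_, rfl⟩
  have hs0 : 0 ≤ s := hs ▸ Nat.cast_nonneg _
  have hs6 : s ^ 6 = ((b : ℝ) ^ 6) ^ (n + 1) := by rw [hs]; push_cast; ring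
  rw [← hs6] at hn2
  have hlow : 8 * b ^ 3 * x < D * s ^ 6 := by
    rw [← mul_div_assoc, div_lt_iff₀ hD0] at hn2
    linarith
  have hup : s ^ 6 ≤ 8 * b ^ 9 * (x / D) := by
    rw [hs6, pow_succ]
    calc _ ≤ 8 * b ^ 3 * (x / D) * (b : ℝ) ^ 6 := by gcongr
      _ = _ := by ring
  refine ⟨n + 1, n.succ_ne_zero, ?_, ?_, ?_, ?_, ?_⟩
  · have h1 : ((b : ℝ) ^ 6) ^ n ≤ (b : ℝ) ^ 6 * x := by
      refine hn1.trans ?_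
      have h8 : (2 : ℝ) ^ 3 ≤ (b : ℝ) ^ 3 := by gcongr
      calc 8 * b ^ 3 * (x / D) ≤ (b : ℝ) ^ 3 * b ^ 3 * x := by
            gcongr
            · linarith
            · exact div_le_self hx0.le hD
        _ = _ := by ring
    have h2 := Real.log_le_log (by positivity) h1
    rw [Real.log_pow, Real.log_mul (by positivity) hx0.ne'] at h2
    have h3 : 1 ≤ Real.log ((b : ℝ) ^ 6) := by
      have := Real.log_le_log (by norm_num) hb6
      rw [Real.log_pow] at this
      push_cast at this
      linarith [Real.log_two_gt_d9]
    have hlog := Real.log_nonneg hx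
    push_cast
    by_contra! h
    nlinarith
  · rw [← hs]
    refine lt_of_pow_lt_pow_left₀ 3 (by positivity) ?_
    have h1 : (8 * b ^ 3 * x) ^ 2 < (D * s ^ 6) ^ 2 := by gcongr
    have h2 : D ^ 2 * (2 * b * D) ^ 3 ≤ (8 * b ^ 3 * x) ^ 2 := by
      have h3 : (8 : ℝ) * b ^ 3 ≤ 64 * b ^ 6 := by
        gcongr <;> linarith
      calc D ^ 2 * (2 * b * D) ^ 3 = 8 * b ^ 3 * D ^ 5 := by ring
        _ ≤ 64 * b ^ 6 * x ^ 2 := by gcongr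
        _ = _ := by ring
    have h4 : D ^ 2 * (2 * b * D) ^ 3 < D ^ 2 * (s ^ 4) ^ 3 := by
      calc _ < (D * s ^ 6) ^ 2 := h2.trans_lt h1
        _ = _ := by ring
    exact lt_of_mul_lt_mul_left h4 (by positivity)
  · rw [← hs]
    refine lt_of_pow_lt_pow_left₀ 3 (by positivity) ?_
    have h3 : (b : ℝ) ^ 3 ≤ 64 * b ^ 6 := by
      have : (b : ℝ) ^ 3 ≤ b ^ 6 := pow_le_pow_right₀ (by linarith) (by norm_num)
      linarith [pow_nonneg (show (0 : ℝ) ≤ b by linarith) 6]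
    calc (b * x) ^ 3 = b ^ 3 * (x ^ 2 * x) := by ring
      _ ≤ 64 * b ^ 6 * (x ^ 2 * D ^ 4) := by gcongr
      _ = (8 * b ^ 3 * x) ^ 2 * D ^ 4 := by ring
      _ < (D * s ^ 6) ^ 2 * D ^ 4 := by gcongr
      _ = _ := by ring
  · rw [← hs]
    refine le_trans ?_ hlow.le
    have : (b : ℝ) ≤ 8 * b ^ 3 := by
      have := le_self_pow₀ (show (1 : ℝ) ≤ b by linarith) (show 3 ≠ 0 by norm_num)
      linarith
    gcongr
  · rw [← hs]
    refine le_of_pow_le_pow_left₀ (n := 3) (by norm_num) (by positivity) ?_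
    calc (s ^ 4) ^ 3 = (s ^ 6) ^ 2 := by ring
      _ ≤ (8 * b ^ 9 * (x / D)) ^ 2 := by gcongr
      _ = 64 * b ^ 18 * (x / D) ^ 2 := by ring
      _ = (4 * b ^ 6) ^ 3 * ((x / D) ^ ((2 : ℝ) / 3)) ^ 3 := by
        have : ((x / D) ^ ((2 : ℝ) / 3)) ^ 3 = (x / D) ^ 2 := by
          rw [← Real.rpow_mul_natCast (by positivity)]
          norm_num
        rw [this]
        ring
      _ = _ := by ring

/-- For all `b ≥ 2`, `x^{1/4} ≤ D ≤ x^{2/5}` and `ε > 0`,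
`S_b(x,D) ≪_{b,ε} x^{2/3} / D^{2/3-ε}`. -/
theorem Scount_le_B_process (b : ℕ) (hb : 2 ≤ b) (ε : ℝ) (hε : 0 < ε) :
    ∃ C : ℝ, ∀ x D : ℝ, 1 ≤ x → x ^ ((1 : ℝ) / 4) ≤ D → D ≤ x ^ ((2 : ℝ) / 5) →
      (Scount b x D : ℝ) ≤ C * x ^ ((2 : ℝ) / 3) / D ^ ((2 : ℝ) / 3 - ε) := by
  obtain ⟨C, hC, hCx⟩ := exists_pow_mul_le_rpow b (show 0 < ε / 4 by positivity)
  refine ⟨503 * b * 3 ^ b.primeFactors.card * C * (4 * b ^ 6), fun x D hx h1 h2 => ?_⟩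
  have hx0 : 0 < x := zero_lt_one.trans_le hx
  have hD : 1 ≤ D := (Real.one_le_rpow hx (by norm_num)).trans h1
  have hD0 : 0 < D := zero_lt_one.trans_le hD
  have hxD : x ≤ D ^ 4 := by
    calc x = (x ^ ((1 : ℝ) / 4)) ^ 4 := by
          rw [← Real.rpow_mul_natCast hx0.le]; norm_num
      _ ≤ D ^ 4 := by gcongr
  have hDx : D ^ 5 ≤ x ^ 2 := by
    calc D ^ 5 ≤ (x ^ ((2 : ℝ) / 5)) ^ 5 := by gcongr
      _ = x ^ 2 := by rw [← Real.rpow_mul_natCast hx0.le]; norm_num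
  obtain ⟨k, hk0, hk, H1, H2, H3, H4⟩ := exists_balancing_exponent hb hD hxD hDx hx
  have hfin : {n : ℕ | n ∈ PstarSet b x ∧
      ∃ d : ℕ, D ≤ (d : ℝ) ∧ (d : ℝ) ≤ 2 * D ∧ d ^ 2 ∣ n}.Finite :=
    (Set.finite_le_nat ⌊x⌋₊).subset fun n hn => Nat.le_floor hn.1.2.1
  have hS := card_palindrome_square_multiples_le (k := k) hb hD hfin.toFinset
    (x := x) (fun n hn => ?_) H1 H2 H3
  · rw [← Set.ncard_eq_toFinset_card _ hfin, Nat.primeFactors_pow b hk0] at hS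
    have hτ : ((b ^ k).divisors.card : ℝ) ≤ (b * k + 1) ^ b := by
      exact_mod_cast card_divisors_pow_le b k (by omega)
    have hℓ := natLog_floor_le hb hx
    have hlog := hCx x hx k (Nat.log b ⌊x⌋₊ + 2 : ℕ) (by positivity) (by positivity) hk
      (by push_cast; linarith)
    have hxε : x ^ (ε / 4) ≤ D ^ ε := by
      calc x ^ (ε / 4) ≤ (D ^ 4) ^ (ε / 4) := by gcongr
        _ = D ^ ε := by
          rw [← Real.rpow_natCast_mul hD0.le]
          congr 1
          push_cast
          ring
    obtain ⟨K, hK⟩ : ∃ K : ℝ, K = 503 * b * 3 ^ b.primeFactors.card := ⟨_, rfl⟩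
    have hK0 : 0 ≤ K := hK ▸ by positivity
    rw [← hK] at hS ⊢
    calc (Scount b x D : ℝ)
        ≤ K * (b ^ k).divisors.card * (Nat.log b ⌊x⌋₊ + 2 : ℕ) * ((b ^ k : ℕ) : ℝ) ^ 4 := hS
      _ ≤ K * (b * k + 1) ^ b * (Nat.log b ⌊x⌋₊ + 2 : ℕ) *
          (4 * b ^ 6 * (x / D) ^ ((2 : ℝ) / 3)) := by gcongr
      _ = K * ((b * k + 1) ^ b * (Nat.log b ⌊x⌋₊ + 2 : ℕ)) *
          (4 * b ^ 6 * (x / D) ^ ((2 : ℝ) / 3)) := by ring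
      _ ≤ K * (C * D ^ ε) * (4 * b ^ 6 * (x / D) ^ ((2 : ℝ) / 3)) := by
          refine mul_le_mul_of_nonneg_right (mul_le_mul_of_nonneg_left ?_ hK0) (by positivity)
          exact hlog.trans (by gcongr)
      _ = _ := by
          rw [Real.div_rpow hx0.le hD0.le, Real.rpow_sub hD0]
          field_simp
  · obtain ⟨⟨hn0, hnx, hpal, hgcd⟩, hd⟩ := hfin.mem_toFinset.mp hn
    refine ⟨hn0, hnx, hpal.2, ?_, hd⟩
    exact Nat.Coprime.coprime_dvd_right (Nat.dvd_sub (dvd_pow_self b (by norm_num)) dvd_rfl) hgcd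
end

section
/- For all b ≥ 2 and every ε with 0 < ε < 0.25, there is a constant C = C(b,ε) such that whenever x^{1/4+3ε} ≤ D ≤ x^{2/5} one has S_b(x,D) ≤ C x^{1/2−ε}. -/
theorem Nat.digits_palindrome_close {b n n' k l : ℕ} (hb : 2 ≤ b)
    (hn : (Nat.digits b n).Palindrome) (hn' : (Nat.digits b n').Palindrome)
    (hl : (Nat.digits b n).length = l) (hl' : (Nat.digits b n').length = l)
    (h : n ≡ n' [MOD b ^ k]) : |(n : ℝ) - n'| * (b ^ k : ℕ) ≤ (b ^ l : ℕ) := by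
  have hlt : n < b ^ l := hl ▸ Nat.lt_base_pow_length_digits hb
  have hlt' : n' < b ^ l := hl' ▸ Nat.lt_base_pow_length_digits hb
  rcases le_total l k with hk | hk
  · have hle : b ^ l ≤ b ^ k := Nat.pow_le_pow_right (by omega) hk
    have : n = n' := Nat.ModEq.eq_of_lt_of_lt h (by omega) (by omega)
    simp [this]
  have htake : (Nat.digits b n).take k = (Nat.digits b n').take k := by
    apply Nat.ofDigits_inj_of_len_eq (b := b) (by omega)
    · simp [hl, hl']
    · exact fun d hd => Nat.digits_lt_base hb (List.mem_of_mem_take hd)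
    · exact fun d hd => Nat.digits_lt_base hb (List.mem_of_mem_take hd)
    · rw [← Nat.self_mod_pow_eq_ofDigits_take k n hb, ← Nat.self_mod_pow_eq_ofDigits_take k n' hb]
      exact h
  have hdrop : (Nat.digits b n).drop (l - k) = (Nat.digits b n').drop (l - k) := by
    rw [← hn.reverse_eq, ← hn'.reverse_eq, List.drop_reverse, List.drop_reverse, hl, hl',
      Nat.sub_sub_self hk, htake]
  have hdiv : n / b ^ (l - k) = n' / b ^ (l - k) := by
    rw [Nat.self_div_pow_eq_ofDigits_drop _ _ hb, Nat.self_div_pow_eq_ofDigits_drop _ _ hb, hdrop]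
  have hpos : 0 < b ^ (l - k) := by positivity
  have h1 := Nat.div_add_mod n (b ^ (l - k))
  have h2 := Nat.div_add_mod n' (b ^ (l - k))
  have h3 := Nat.mod_lt n hpos
  have h4 := Nat.mod_lt n' hpos
  rw [hdiv] at h1
  generalize n % b ^ (l - k) = r at h1 h3
  generalize n' % b ^ (l - k) = r' at h2 h4
  have habs : |(n : ℝ) - n'| ≤ (b ^ (l - k) : ℕ) := by
    have h5 : n ≤ n' + b ^ (l - k) := by omega
    have h6 : n' ≤ n + b ^ (l - k) := by omega
    have h5' : (n : ℝ) ≤ n' + (b ^ (l - k) : ℕ) := by exact_mod_cast h5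
    have h6' : (n' : ℝ) ≤ n + (b ^ (l - k) : ℕ) := by exact_mod_cast h6
    rw [abs_le]
    constructor <;> linarith
  calc |(n : ℝ) - n'| * (b ^ k : ℕ) ≤ (b ^ (l - k) : ℕ) * (b ^ k : ℕ) := by gcongr
    _ = (b ^ l : ℕ) := by
      rw [← Nat.cast_mul, ← pow_add, Nat.sub_add_cancel hk]

/-- A finite family of reals with mutual distances in `[μ, W]` has at most `W / μ + 1` members. -/
theorem Finset.card_le_of_spaced {ι : Type*} (T : Finset ι) (g : ι → ℝ) {μ W : ℝ} (hμ : 0 < μ)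
    (hW : 0 ≤ W) (hsp : ∀ s ∈ T, ∀ t ∈ T, s ≠ t → μ ≤ |g s - g t|)
    (hle : ∀ s ∈ T, ∀ t ∈ T, |g s - g t| ≤ W) : (T.card : ℝ) ≤ W / μ + 1 := by
  rcases T.eq_empty_or_nonempty with rfl | hne
  · simp; positivity
  obtain ⟨t₀, ht₀, hmin⟩ := T.exists_min_image g hne
  have hcard : T.card ≤ (Finset.range (⌊W / μ⌋₊ + 1)).card := by
    apply Finset.card_le_card_of_injOn (fun t => ⌊(g t - g t₀) / μ⌋₊)
    · intro t ht
      simp only [Finset.coe_range, Set.mem_Iio, Nat.lt_succ_iff]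
      gcongr
      exact (le_abs_self _).trans (hle t ht t₀ ht₀)
    · intro s hs t ht hst
      by_contra hne'
      have h1 := hsp s hs t ht hne'
      have hs0 : 0 ≤ (g s - g t₀) / μ := div_nonneg (sub_nonneg.2 (hmin s hs)) hμ.le
      have ht0 : 0 ≤ (g t - g t₀) / μ := div_nonneg (sub_nonneg.2 (hmin t ht)) hμ.le
      have a1 := Nat.floor_le hs0
      have a2 := Nat.floor_le ht0
      have a3 := Nat.lt_floor_add_one ((g s - g t₀) / μ)
      have a4 := Nat.lt_floor_add_one ((g t - g t₀) / μ)
      simp only at hst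
      rw [hst] at a1 a3
      have h2 : |(g s - g t₀) / μ - (g t - g t₀) / μ| < 1 := by
        rw [abs_lt]; constructor <;> linarith
      rw [← sub_div, abs_div, abs_of_pos hμ, div_lt_one hμ] at h2
      have : g s - g t₀ - (g t - g t₀) = g s - g t := by ring
      rw [this] at h2
      linarith
  rw [Finset.card_range] at hcard
  calc (T.card : ℝ) ≤ (⌊W / μ⌋₊ + 1 : ℕ) := by exact_mod_cast hcard
    _ ≤ W / μ + 1 := by
      push_cast
      gcongr
      exact Nat.floor_le (by positivity)

/-- A map with fibres of size at most `B` from `T` into a set of size at most `A`. -/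
theorem Finset.card_le_mul_of_fibers {ι κ : Type*} [DecidableEq κ] (T : Finset ι) (f : ι → κ)
    {A B : ℝ} (hB : 0 ≤ B) (hA : ((T.image f).card : ℝ) ≤ A)
    (hf : ∀ c ∈ T.image f, ((T.filter (fun t => f t = c)).card : ℝ) ≤ B) :
    (T.card : ℝ) ≤ A * B := by
  rw [Finset.card_eq_sum_card_image f T]
  push_cast
  calc _ ≤ ∑ _c ∈ T.image f, B := Finset.sum_le_sum hf
    _ = (T.image f).card * B := by simp
    _ ≤ A * B := by gcongr

/-- Well-spaced reals in an interval of length `W`, each within `δ` of an integer. -/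
theorem Finset.card_le_of_spaced_near_int {ι : Type*} (T : Finset ι) (g : ι → ℝ) {μ W δ : ℝ}
    (hμ : 0 < μ) (hW : 0 ≤ W) (hδ : 0 ≤ δ)
    (hsp : ∀ s ∈ T, ∀ t ∈ T, s ≠ t → μ ≤ |g s - g t|)
    (hle : ∀ s ∈ T, ∀ t ∈ T, |g s - g t| ≤ W) (hnearZ : ∀ t ∈ T, ∃ z : ℤ, |g t - z| ≤ δ) :
    (T.card : ℝ) ≤ (W + 2 * δ + 1) * (2 * δ / μ + 1) := by
  classical
  choose! z hz using hnearZ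
  apply Finset.card_le_mul_of_fibers T z (by positivity)
  · have := Finset.card_le_of_spaced (T.image z) (fun m : ℤ => (m : ℝ)) one_pos
      (W := W + 2 * δ) (by positivity) ?_ ?_
    · simpa using this
    · intro s _ t _ hst
      have : (1 : ℤ) ≤ |s - t| := Int.one_le_abs (sub_ne_zero.2 hst)
      exact_mod_cast this
    · simp only [Finset.mem_image]
      rintro _ ⟨s, hs, rfl⟩ _ ⟨t, ht, rfl⟩
      have h1 := abs_le.1 (hz s hs)
      have h2 := abs_le.1 (hz t ht)
      have h3 := abs_le.1 (hle s hs t ht)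
      rw [abs_le]
      constructor <;> linarith
  · intro c _
    apply Finset.card_le_of_spaced _ g hμ (by positivity)
    · intro s hs t ht
      exact hsp s (Finset.mem_filter.1 hs).1 t (Finset.mem_filter.1 ht).1
    · intro s hs t ht
      obtain ⟨hsT, hsc⟩ := Finset.mem_filter.1 hs
      obtain ⟨htT, htc⟩ := Finset.mem_filter.1 ht
      have h1 := abs_le.1 (hz s hsT)
      have h2 := abs_le.1 (hz t htT)
      rw [hsc] at h1
      rw [htc] at h2
      rw [abs_le]
      constructor <;> linarith

/-- Points whose differences inside a block of length `L` make multiples of the slope attached to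
the block nearly integral. -/
theorem Finset.card_le_of_block_slopes (T : Finset ℕ) (L : ℕ) (hL : 0 < L) (α : ℕ → ℝ)
    {μ V δ : ℝ} (hμ : 0 < μ) (hV : 0 ≤ V) (hδ : 0 ≤ δ)
    (hpair : ∀ s ∈ T, ∀ t ∈ T, s < t → s / L = t / L →
      ∃ z : ℤ, |((t - s : ℕ) : ℝ) * α (s / L) - z| ≤ δ)
    (hsp : ∀ i ∈ T.image (· / L), ∀ j ∈ T.image (· / L), i ≠ j → μ ≤ |α i - α j|)
    (hle : ∀ i ∈ T.image (· / L), ∀ j ∈ T.image (· / L), |α i - α j| ≤ V) :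
    (T.card : ℝ) ≤ (T.image (· / L)).card +
      ∑ j ∈ Finset.Ico 1 L, (j * V + 2 * δ + 1) * (2 * δ / (j * μ) + 1) := by
  classical
  set I := T.image (· / L) with hI
  have hfib : ∀ i ∈ I, (T.filter (fun t => t / L = i)).card ≤
      1 + ((Finset.Ico 1 L).filter (fun j : ℕ => ∃ z : ℤ, |(j : ℝ) * α i - z| ≤ δ)).card := by
    intro i hi
    set F := T.filter (fun t => t / L = i) with hF
    have hne : F.Nonempty := by
      obtain ⟨t, ht, rfl⟩ := Finset.mem_image.1 hi
      exact ⟨t, Finset.mem_filter.2 ⟨ht, rfl⟩⟩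
    have hm := F.min'_mem hne
    set s := F.min' hne with hs
    rw [← Finset.card_erase_add_one hm, add_comm]
    gcongr 1 + ?_
    apply Finset.card_le_card_of_injOn (fun t => t - s)
    · intro t ht
      obtain ⟨hts, htF⟩ := Finset.mem_erase.1 (Finset.mem_coe.1 ht)
      have hst : s < t := lt_of_le_of_ne (F.min'_le t htF) (Ne.symm hts)
      obtain ⟨htT, hti⟩ := Finset.mem_filter.1 htF
      obtain ⟨hsT, hsi⟩ := Finset.mem_filter.1 hm
      simp only [Finset.coe_filter, Finset.mem_Ico, Set.mem_ofPred_eq]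
      refine ⟨⟨by omega, ?_⟩, ?_⟩
      · have h1 := Nat.div_add_mod t L
        have h2 := Nat.div_add_mod s L
        have h3 := Nat.mod_lt t hL
        rw [hti] at h1
        rw [hsi] at h2
        omega
      · have := hpair s hsT t htT hst (hsi.trans hti.symm)
        rwa [hsi] at this
    · intro t ht t' ht' h
      have h1 := F.min'_le t (Finset.mem_of_mem_erase (Finset.mem_coe.1 ht))
      have h2 := F.min'_le t' (Finset.mem_of_mem_erase (Finset.mem_coe.1 ht'))
      simp only at h
      omega
  have hsum : T.card ≤ I.card +
      ∑ j ∈ Finset.Ico 1 L, (I.filter (fun i => ∃ z : ℤ, |(j : ℝ) * α i - z| ≤ δ)).card := by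
    rw [Finset.card_eq_sum_card_image (· / L) T]
    refine (Finset.sum_le_sum hfib).trans ?_
    rw [Finset.sum_add_distrib, Finset.sum_const, smul_eq_mul, mul_one]
    simp only [Finset.card_filter]
    rw [Finset.sum_comm]
  calc (T.card : ℝ) ≤ _ := Nat.cast_le.2 hsum
    _ ≤ _ := by
      push_cast
      gcongr with j hj
      have hj1 : (1 : ℝ) ≤ j := by exact_mod_cast (Finset.mem_Ico.1 hj).1
      apply Finset.card_le_of_spaced_near_int _ (fun i => (j : ℝ) * α i) (by positivity)
        (by positivity) hδ
      · intro s hs t ht hst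
        rw [← mul_sub, abs_mul, Nat.abs_cast]
        gcongr
        exact hsp s (Finset.mem_filter.1 hs).1 t (Finset.mem_filter.1 ht).1 hst
      · intro s hs t ht
        rw [← mul_sub, abs_mul, Nat.abs_cast]
        gcongr
        exact hle s (Finset.mem_filter.1 hs).1 t (Finset.mem_filter.1 ht).1
      · exact fun t ht => (Finset.mem_filter.1 ht).2

/-- If `n = (d n)² m` runs over a set where the residue modulo `Q` determines `n` up to `B Y / Q`,
then for fixed `m` and `d n` modulo `Q` the number `d n` lies in a short interval. -/
theorem Finset.card_le_of_sq_dvd (P : Finset ℕ) (d : ℕ → ℕ) {B Y D : ℝ} {Q : ℕ} (hQ : 0 < Q)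
    (hB : 0 ≤ B) (hY0 : 0 < Y) (hD0 : 0 < D) (hY : ∀ n ∈ P, Y ≤ n) (hBY : ∀ n ∈ P, (n : ℝ) ≤ B * Y)
    (hD : ∀ n ∈ P, D ≤ d n) (hD' : ∀ n ∈ P, (d n : ℝ) ≤ 2 * D) (hdvd : ∀ n ∈ P, d n ^ 2 ∣ n)
    (hclose : ∀ n ∈ P, ∀ n' ∈ P, n ≡ n' [MOD Q] → |(n : ℝ) - n'| * Q ≤ B * Y) :
    (P.card : ℝ) ≤ (B * Y / D ^ 2 * Q) * (2 * B * D / Q / Q + 1) := by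
  classical
  have hQ' : (0 : ℝ) < Q := by exact_mod_cast hQ
  have hmul : ∀ n ∈ P, (n : ℝ) = (d n : ℝ) ^ 2 * (n / d n ^ 2 : ℕ) := by
    intro n hn
    exact_mod_cast (Nat.mul_div_cancel' (hdvd n hn)).symm
  apply Finset.card_le_mul_of_fibers P (fun n => (n / d n ^ 2, d n % Q)) (by positivity)
  · have hsub : P.image (fun n => (n / d n ^ 2, d n % Q)) ⊆
        Finset.Icc 1 ⌊B * Y / D ^ 2⌋₊ ×ˢ Finset.range Q := by
      intro x hx
      obtain ⟨n, hn, rfl⟩ := Finset.mem_image.1 hx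
      have h1 := hmul n hn
      have h2 := hY n hn
      have h3 := hBY n hn
      have h4 := hD n hn
      simp only [Finset.mem_product, Finset.mem_Icc, Finset.mem_range]
      refine ⟨⟨?_, ?_⟩, Nat.mod_lt _ hQ⟩
      · rw [Nat.one_le_iff_ne_zero]
        intro h0
        rw [h0] at h1
        simp at h1
        rw [h1] at h2
        simp at h2
        linarith
      · apply Nat.le_floor
        rw [le_div_iff₀ (by positivity)]
        calc _ ≤ ((n / d n ^ 2 : ℕ) : ℝ) * (d n : ℝ) ^ 2 := by gcongr
          _ = n := by rw [h1]; ring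
          _ ≤ B * Y := h3
    have hcard := Finset.card_le_card hsub
    rw [Finset.card_product, Nat.card_Icc, Nat.add_sub_cancel, Finset.card_range] at hcard
    calc _ ≤ ((⌊B * Y / D ^ 2⌋₊ * Q : ℕ) : ℝ) := Nat.cast_le.2 hcard
      _ ≤ _ := by
        push_cast
        gcongr
        exact Nat.floor_le (by positivity)
  · intro c _
    apply Finset.card_le_of_spaced _ (fun n => (d n : ℝ)) hQ' (by positivity)
    · intro n hn n' hn' hne
      obtain ⟨hnP, hnc⟩ := Finset.mem_filter.1 hn
      obtain ⟨hnP', hnc'⟩ := Finset.mem_filter.1 hn'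
      have hcc := hnc.trans hnc'.symm
      simp only [Prod.mk.injEq] at hcc
      have hdd : d n ≠ d n' := by
        intro h
        apply hne
        have h1 := hmul n hnP
        have h2 := hmul n' hnP'
        rw [hcc.1, h, ← h2] at h1
        exact_mod_cast h1
      have hdvdQ : (Q : ℤ) ∣ (d n : ℤ) - d n' := (Nat.ModEq.dvd (Nat.ModEq.symm hcc.2))
      have := Int.le_of_dvd (abs_pos.2 (sub_ne_zero.2 (by exact_mod_cast hdd)))
        ((dvd_abs _ _).2 hdvdQ)
      exact_mod_cast this
    · intro n hn n' hn'
      obtain ⟨hnP, hnc⟩ := Finset.mem_filter.1 hn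
      obtain ⟨hnP', hnc'⟩ := Finset.mem_filter.1 hn'
      have hcc := hnc.trans hnc'.symm
      simp only [Prod.mk.injEq] at hcc
      have h1 := hmul n hnP
      have h2 := hmul n' hnP'
      rw [← hcc.1] at h2
      set m : ℝ := ((n / d n ^ 2 : ℕ) : ℝ) with hm
      have hm0 : 0 ≤ m := Nat.cast_nonneg _
      have hmod : n ≡ n' [MOD Q] := by
        have e1 := Nat.mul_div_cancel' (hdvd n hnP)
        have e2 := Nat.mul_div_cancel' (hdvd n' hnP')
        rw [← hcc.1] at e2
        have h := (Nat.ModEq.pow 2 hcc.2).mul_right (n / d n ^ 2)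
        rwa [e1, e2] at h
      have h3 := hclose n hnP n' hnP' hmod
      have h4 : |(n : ℝ) - n'| = m * ((d n : ℝ) + d n') * |(d n : ℝ) - d n'| := by
        have : (n : ℝ) - n' = m * ((d n : ℝ) + d n') * ((d n : ℝ) - d n') := by
          rw [h1, h2]; ring
        rw [this, abs_mul, abs_of_nonneg (by positivity)]
      have h5 : Y / (2 * D) ≤ m * ((d n : ℝ) + d n') := by
        have a1 := hY n hnP
        have a2 := hD n hnP
        have a3 := hD' n hnP
        have a4 := hD n' hnP'
        have a5 : Y ≤ (2 * D) ^ 2 * m := by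
          calc Y ≤ (d n : ℝ) ^ 2 * m := by rw [← h1]; exact a1
            _ ≤ (2 * D) ^ 2 * m := by gcongr
        rw [div_le_iff₀ (by positivity)]
        calc Y ≤ m * (D + D) * (2 * D) := by linarith
          _ ≤ _ := by gcongr
      rw [h4] at h3
      rw [le_div_iff₀ hQ']
      have h6 : Y / (2 * D) * (|(d n : ℝ) - d n'| * Q) ≤ B * Y := by
        calc _ ≤ m * ((d n : ℝ) + d n') * (|(d n : ℝ) - d n'| * Q) := by gcongr
          _ = m * ((d n : ℝ) + d n') * |(d n : ℝ) - d n'| * Q := by ring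
          _ ≤ _ := h3
      rw [div_mul_eq_mul_div, div_le_iff₀ (by positivity)] at h6
      nlinarith

theorem eq_of_sq_nilpotent_shift {A : Type*} [CommRing A] {R d e t m a : A} (hR : R ^ 2 = 0)
    (he : d * e = 1) (h : (d + R * t) ^ 2 * m = a) :
    m = a * e ^ 2 * (1 - 2 * R * t * e) := by
  have h1 : (d + R * t) ^ 2 * e ^ 2 * (1 - 2 * R * t * e) = 1 := by
    have : (d + R * t) ^ 2 * e ^ 2 * (1 - 2 * R * t * e) =
      (d * e) ^ 2 + 2 * R * (t * e) * (d * e) * (1 - d * e) +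
      R ^ 2 * (t ^ 2 * e ^ 2 - 4 * t ^ 2 * e ^ 2 * (d * e) - 2 * R * t ^ 3 * e ^ 3) := by ring
    rw [this, he, hR]
    ring
  calc m = ((d + R * t) ^ 2 * e ^ 2 * (1 - 2 * R * t * e)) * m := by rw [h1, one_mul]
    _ = ((d + R * t) ^ 2 * m) * e ^ 2 * (1 - 2 * R * t * e) := by ring
    _ = _ := by rw [h]

theorem inv_sq_expansion {A u h : ℝ} (hA : 0 ≤ A) (hu : 0 < u) (hh : 0 ≤ h) :
    0 ≤ A / (u + h) ^ 2 - A / u ^ 2 + 2 * A * h / u ^ 3 ∧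
      A / (u + h) ^ 2 - A / u ^ 2 + 2 * A * h / u ^ 3 ≤ 3 * A * h ^ 2 / u ^ 4 := by
  have h1 : A / (u + h) ^ 2 - A / u ^ 2 + 2 * A * h / u ^ 3 =
      A * h ^ 2 * (3 * u + 2 * h) / (u ^ 3 * (u + h) ^ 2) := by
    field_simp
    ring
  rw [h1]
  refine ⟨by positivity, ?_⟩
  rw [div_le_div_iff₀ (by positivity) (by positivity)]
  have h2 : (3 * u + 2 * h) * u ≤ 3 * (u + h) ^ 2 := by nlinarith [mul_nonneg hu.le hh]
  calc A * h ^ 2 * (3 * u + 2 * h) * u ^ 4 = (A * h ^ 2 * u ^ 3) * ((3 * u + 2 * h) * u) := by ring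
    _ ≤ (A * h ^ 2 * u ^ 3) * (3 * (u + h) ^ 2) := by gcongr
    _ = _ := by ring

theorem inv_cube_sub_bounds {u v D : ℝ} (hD : 0 < D) (hu : D ≤ u) (huv : u ≤ v) (hv : v ≤ 2 * D) :
    3 * (v - u) / (2 * D) ^ 4 ≤ 1 / u ^ 3 - 1 / v ^ 3 ∧
      1 / u ^ 3 - 1 / v ^ 3 ≤ 3 * (v - u) / D ^ 4 := by
  have hu0 : 0 < u := hD.trans_le hu
  have hv0 : 0 < v := hu0.trans_le huv
  have h1 : 1 / u ^ 3 - 1 / v ^ 3 =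
      (v - u) * (1 / (u * v ^ 3) + 1 / (u ^ 2 * v ^ 2) + 1 / (u ^ 3 * v)) := by
    field_simp
    ring
  have hw : 0 ≤ v - u := sub_nonneg.2 huv
  have hu' : u ≤ 2 * D := huv.trans hv
  have hv' : D ≤ v := hu.trans huv
  rw [h1]
  constructor
  · have : 3 * (v - u) / (2 * D) ^ 4 = (v - u) * (1 / (2 * D * (2 * D) ^ 3) +
        1 / ((2 * D) ^ 2 * (2 * D) ^ 2) + 1 / ((2 * D) ^ 3 * (2 * D))) := by
      field_simp
      ring
    rw [this]
    gcongr
  · have : 3 * (v - u) / D ^ 4 = (v - u) * (1 / (D * D ^ 3) +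
        1 / (D ^ 2 * D ^ 2) + 1 / (D ^ 3 * D)) := by
      field_simp
      ring
    rw [this]
    gcongr

/-- The second-derivative estimate on a single residue class of `n` modulo `Q` and of `d n`
modulo `R`. -/
theorem Finset.card_class_le_of_sq_dvd (F : Finset ℕ) (d : ℕ → ℕ) {B Y D δ μ V : ℝ} {Q R L : ℕ}
    (hQ : 0 < Q) (hR : 0 < R) (hL : 0 < L) (hQR : Q ∣ R ^ 2)
    (hB : 0 ≤ B) (hY0 : 0 < Y) (hD0 : 0 < D) (hY : ∀ n ∈ F, Y ≤ n) (hBY : ∀ n ∈ F, (n : ℝ) ≤ B * Y)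
    (hD : ∀ n ∈ F, D ≤ d n) (hD' : ∀ n ∈ F, (d n : ℝ) ≤ 2 * D) (hdvd : ∀ n ∈ F, d n ^ 2 ∣ n)
    (hcop : ∀ n ∈ F, (d n).Coprime Q) (hQD : B * Y < Q ^ 2 * D ^ 2)
    (hmodQ : ∀ n ∈ F, ∀ n' ∈ F, n ≡ n' [MOD Q]) (hmodR : ∀ n ∈ F, ∀ n' ∈ F, d n ≡ d n' [MOD R])
    (hclose : ∀ n ∈ F, ∀ n' ∈ F, |(n : ℝ) - n'| * Q ≤ B * Y)
    (hδ : δ = (2 * (B * Y) / (Q * D ^ 2) + 3 * (B * Y) * (R * L) ^ 2 / D ^ 4) / Q)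
    (hμ : μ = R / Q * (2 * Y * (3 * (R * L) / (2 * D) ^ 4)))
    (hV : V = R / Q * (2 * (B * Y) * (3 * D / D ^ 4))) :
    (F.card : ℝ) ≤ D / (R * L) + 1 +
      ∑ j ∈ Finset.Ico 1 L, (j * V + 2 * δ + 1) * (2 * δ / (j * μ) + 1) := by
  classical
  have hQ' : (0 : ℝ) < Q := by exact_mod_cast hQ
  have hR' : (0 : ℝ) < R := by exact_mod_cast hR
  have hL' : (0 : ℝ) < L := by exact_mod_cast hL
  have hδ0 : 0 ≤ δ := by rw [hδ]; positivity
  have hμ0 : 0 < μ := by rw [hμ]; positivity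
  have hV0 : 0 ≤ V := by rw [hV]; positivity
  have : NeZero Q := ⟨hQ.ne'⟩
  rcases F.eq_empty_or_nonempty with rfl | hne
  · simp only [Finset.card_empty, Nat.cast_zero]
    positivity
  obtain ⟨n₀, hn₀, hmin⟩ := F.exists_min_image d hne
  obtain ⟨s, hs⟩ : ∃ s : ℕ → ℕ, ∀ n ∈ F, d n = d n₀ + R * s n := by
    refine ⟨fun n => (d n - d n₀) / R, fun n hn => ?_⟩
    have h1 : R ∣ d n - d n₀ := (Nat.modEq_iff_dvd' (hmin n hn)).1 (hmodR n₀ hn₀ n hn)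
    rw [Nat.mul_div_cancel' h1, Nat.add_sub_cancel' (hmin n hn)]
  obtain ⟨m, hm⟩ : ∃ m : ℕ → ℕ, ∀ n ∈ F, d n ^ 2 * m n = n :=
    ⟨fun n => n / d n ^ 2, fun n hn => Nat.mul_div_cancel' (hdvd n hn)⟩
  obtain ⟨e, he⟩ := ZMod.intCast_surjective ((d n₀ : ZMod Q)⁻¹)
  have hde : (d n₀ : ZMod Q) * (e : ZMod Q) = 1 := by
    rw [he]
    exact ZMod.coe_mul_inv_eq_one _ (hcop n₀ hn₀)
  have hR2 : (R : ZMod Q) ^ 2 = 0 := by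
    rw [← Nat.cast_pow]
    exact (ZMod.natCast_eq_zero_iff _ _).2 hQR
  have hmform : ∀ n ∈ F, (m n : ZMod Q) =
      (n₀ : ZMod Q) * (e : ZMod Q) ^ 2 * (1 - 2 * R * (s n : ZMod Q) * e) := by
    intro n hn
    apply eq_of_sq_nilpotent_shift hR2 hde
    have h1 : ((d n ^ 2 * m n : ℕ) : ZMod Q) = (n₀ : ZMod Q) := by
      rw [hm n hn]
      exact (ZMod.natCast_eq_natCast_iff _ _ _).2 (hmodQ n hn n₀ hn₀)
    rw [← h1, hs n hn]
    push_cast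
    ring
  set c : ℤ := 2 * n₀ * e ^ 3 with hc
  have hnearZ : ∀ n ∈ F, ∀ n' ∈ F, ∃ z : ℤ,
      (m n' : ℝ) - m n + R * ((s n' : ℝ) - s n) * c = Q * z := by
    intro n hn n' hn'
    have h1 : (((m n' : ℤ) - m n + R * ((s n' : ℤ) - s n) * c : ℤ) : ZMod Q) = 0 := by
      rw [hc]
      push_cast
      rw [hmform n hn, hmform n' hn']
      ring
    obtain ⟨z, hz⟩ := (ZMod.intCast_zmod_eq_zero_iff_dvd _ _).1 h1
    exact ⟨z, by exact_mod_cast hz⟩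
  have hsq : ∀ n ∈ F, D ^ 2 ≤ (d n : ℝ) ^ 2 := fun n hn => by
    have := hD n hn
    gcongr
  have hinj : Set.InjOn s F := by
    intro n hn n' hn' hss
    have hdd : d n = d n' := by rw [hs n hn, hs n' hn', hss]
    have h1 : (m n : ℝ) = m n' := by
      obtain ⟨z, hz⟩ := hnearZ n hn n' hn'
      rw [hss] at hz
      simp only [sub_self, mul_zero, zero_mul, add_zero] at hz
      have h2 := hclose n' hn' n hn
      have e1 : (n : ℝ) = (d n : ℝ) ^ 2 * m n := by exact_mod_cast (hm n hn).symm
      have e2 : (n' : ℝ) = (d n : ℝ) ^ 2 * m n' := by rw [hdd]; exact_mod_cast (hm n' hn').symm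
      have e3 : |(n' : ℝ) - n| = (d n : ℝ) ^ 2 * (Q * |(z : ℝ)|) := by
        rw [e1, e2, ← mul_sub, hz, abs_mul, abs_mul, abs_of_nonneg (sq_nonneg _),
          abs_of_pos hQ']
      rw [e3] at h2
      have h3 : Q ^ 2 * D ^ 2 * |(z : ℝ)| < Q ^ 2 * D ^ 2 * 1 := by
        calc Q ^ 2 * D ^ 2 * |(z : ℝ)| ≤ Q ^ 2 * (d n : ℝ) ^ 2 * |(z : ℝ)| := by
              have := hsq n hn
              gcongr
          _ = (d n : ℝ) ^ 2 * (Q * |(z : ℝ)|) * Q := by ring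
          _ ≤ B * Y := h2
          _ < _ := by rw [mul_one]; exact hQD
      have h4 : |(z : ℝ)| < 1 := lt_of_mul_lt_mul_left h3 (by positivity)
      have h5 : z = 0 := by
        rw [← Int.abs_lt_one_iff]
        exact_mod_cast h4
      rw [h5] at hz
      simp at hz
      linarith
    have h2 : m n = m n' := by exact_mod_cast h1
    rw [← hm n hn, ← hm n' hn', hdd, h2]
  rw [← Finset.card_image_of_injOn hinj]
  set α : ℕ → ℝ := fun i => R / Q * (c - 2 * n₀ / ((d n₀ : ℝ) + R * L * i) ^ 3) with hα
  have hn₀pos : (0 : ℝ) < n₀ := hY0.trans_le (hY n₀ hn₀)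
  have hd₀ := hD n₀ hn₀
  have hu : ∀ i : ℕ, D ≤ (d n₀ : ℝ) + R * L * i := by
    intro i
    have : (0 : ℝ) ≤ R * L * i := by positivity
    linarith
  have hblock : ∀ n ∈ F, (d n : ℝ) = ((d n₀ : ℝ) + R * L * (s n / L : ℕ)) + R * (s n % L : ℕ) := by
    intro n hn
    have h1 : d n = (d n₀ + R * L * (s n / L)) + R * (s n % L) := by
      rw [hs n hn]
      nth_rewrite 1 [← Nat.div_add_mod (s n) L]
      ring
    exact_mod_cast h1
  have hu' : ∀ i ∈ (F.image s).image (· / L), (d n₀ : ℝ) + R * L * i ≤ 2 * D := by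
    intro i hi
    obtain ⟨t, ht, rfl⟩ := Finset.mem_image.1 hi
    obtain ⟨n, hn, rfl⟩ := Finset.mem_image.1 ht
    have h1 := hD' n hn
    have h2 := hblock n hn
    have h3 : (0 : ℝ) ≤ R * (s n % L : ℕ) := by positivity
    linarith
  have hαdiff : ∀ i ∈ (F.image s).image (· / L), ∀ j ∈ (F.image s).image (· / L), i < j →
      μ ≤ α j - α i ∧ α j - α i ≤ V := by
    intro i hi j hj hij
    have hij' : (1 : ℝ) ≤ (j : ℝ) - i := by
      have : (i : ℝ) + 1 ≤ j := by exact_mod_cast hij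
      linarith
    have hle : (d n₀ : ℝ) + R * L * i ≤ (d n₀ : ℝ) + R * L * j := by gcongr
    obtain ⟨h1, h2⟩ := inv_cube_sub_bounds hD0 (hu i) hle (hu' j hj)
    have h3 : α j - α i = R / Q * (2 * n₀ * (1 / ((d n₀ : ℝ) + R * L * i) ^ 3 -
        1 / ((d n₀ : ℝ) + R * L * j) ^ 3)) := by
      rw [hα]; ring
    have hYn := hY n₀ hn₀
    have hBYn := hBY n₀ hn₀
    have h4 : (d n₀ : ℝ) + R * L * j - (d n₀ + R * L * i) = R * L * (j - i) := by ring
    have h5 : R * L * ((j : ℝ) - i) ≤ D := by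
      rw [← h4]
      linarith [hu' j hj, hu i]
    rw [h4] at h1 h2
    rw [h3, hμ, hV]
    constructor
    · have h6 : 3 * (R * L) / (2 * D) ^ 4 ≤ 3 * (R * L * ((j : ℝ) - i)) / (2 * D) ^ 4 :=
        div_le_div_of_nonneg_right (mul_le_mul_of_nonneg_left
          (le_mul_of_one_le_right (by positivity) hij') (by norm_num)) (by positivity)
      have h7 := h6.trans h1
      gcongr
    · have h6 : 3 * (R * L * ((j : ℝ) - i)) / D ^ 4 ≤ 3 * D / D ^ 4 := by gcongr
      have h7 := h2.trans h6
      have h8 : 0 ≤ 3 * D / D ^ 4 := by positivity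
      calc _ ≤ R / Q * (2 * n₀ * (3 * D / D ^ 4)) := by gcongr
        _ ≤ _ := by gcongr
  have hαabs : ∀ i ∈ (F.image s).image (· / L), ∀ j ∈ (F.image s).image (· / L), i ≠ j →
      μ ≤ |α i - α j| ∧ |α i - α j| ≤ V := by
    intro i hi j hj hij
    rcases lt_or_gt_of_ne hij with h | h
    · obtain ⟨h1, h2⟩ := hαdiff i hi j hj h
      rw [abs_sub_comm, abs_of_nonneg (hμ0.le.trans h1)]
      exact ⟨h1, h2⟩
    · obtain ⟨h1, h2⟩ := hαdiff j hj i hi h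
      rw [abs_of_nonneg (hμ0.le.trans h1)]
      exact ⟨h1, h2⟩
  have hmain := Finset.card_le_of_block_slopes (F.image s) L hL α hμ0 hV0 hδ0 ?_
    (fun i hi j hj hij => (hαabs i hi j hj hij).1) ?_
  · refine hmain.trans ?_
    gcongr
    have h1 := Finset.card_le_of_spaced ((F.image s).image (· / L)) (fun i : ℕ => (i : ℝ))
      (μ := 1) (W := D / (R * L)) one_pos (by positivity) ?_ ?_
    · simpa using h1
    · intro i _ j _ hij
      have : (1 : ℤ) ≤ |(i : ℤ) - j| := Int.one_le_abs (sub_ne_zero.2 (by exact_mod_cast hij))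
      exact_mod_cast this
    · intro i hi j hj
      have a1 := hu' i hi
      have a2 := hu' j hj
      have a3 : (0 : ℝ) ≤ R * L * i := by positivity
      have a4 : (0 : ℝ) ≤ R * L * j := by positivity
      rw [le_div_iff₀ (by positivity), ← abs_of_pos (show (0 : ℝ) < R * L by positivity), ← abs_mul,
        abs_le]
      constructor <;> linarith
  · intro x hx y hy hxy hdiv
    obtain ⟨n, hn, rfl⟩ := Finset.mem_image.1 hx
    obtain ⟨n', hn', rfl⟩ := Finset.mem_image.1 hy
    obtain ⟨z, hz⟩ := hnearZ n hn n' hn'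
    refine ⟨z, ?_⟩
    rw [Nat.cast_sub hxy.le]
    have b1 := hblock n hn
    have b2 := hblock n' hn'
    rw [← hdiv] at b2
    have hui := hu (s n / L)
    have hαi : α (s n / L) = R / Q * (c - 2 * n₀ / ((d n₀ : ℝ) + R * L * (s n / L : ℕ)) ^ 3) := rfl
    set u : ℝ := (d n₀ : ℝ) + R * L * (s n / L : ℕ) with hu_def
    have hu0 : 0 < u := hD0.trans_le hui
    set h : ℝ := R * (s n % L : ℕ) with hh
    set h' : ℝ := R * (s n' % L : ℕ) with hh'
    have hh0 : 0 ≤ h := by positivity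
    have hh0' : 0 ≤ h' := by positivity
    have hhL : h ≤ R * L := by
      rw [hh]
      gcongr
      exact (Nat.mod_lt _ hL).le
    have hhL' : h' ≤ R * L := by
      rw [hh']
      gcongr
      exact (Nat.mod_lt _ hL).le
    have hhd : h' - h = R * ((s n' : ℝ) - s n) := by
      have e1 : (d n : ℝ) = d n₀ + R * s n := by exact_mod_cast hs n hn
      have e2 : (d n' : ℝ) = d n₀ + R * s n' := by exact_mod_cast hs n' hn'
      linarith
    obtain ⟨p1, p2⟩ := inv_sq_expansion hn₀pos.le hu0 hh0
    obtain ⟨p3, p4⟩ := inv_sq_expansion hn₀pos.le hu0 hh0'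
    rw [← b1] at p1 p2
    rw [← b2] at p3 p4
    have hE : ∀ k : ℝ, 0 ≤ k → k ≤ R * L →
        3 * n₀ * k ^ 2 / u ^ 4 ≤ 3 * (B * Y) * (R * L) ^ 2 / D ^ 4 := by
      intro k hk hkL
      have := hBY n₀ hn₀
      gcongr
    have q1 := hE h hh0 hhL
    have q2 := hE h' hh0' hhL'
    have happ : ∀ k ∈ F, |(m k : ℝ) - n₀ / (d k : ℝ) ^ 2| ≤ (B * Y) / (Q * D ^ 2) := by
      intro k hk
      have hdk : (0 : ℝ) < d k := hD0.trans_le (hD k hk)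
      have e1 : (k : ℝ) = (d k : ℝ) ^ 2 * m k := by exact_mod_cast (hm k hk).symm
      have e2 : (m k : ℝ) - n₀ / (d k : ℝ) ^ 2 = ((k : ℝ) - n₀) / (d k : ℝ) ^ 2 := by
        rw [e1]; field_simp
      rw [e2, abs_div, abs_of_nonneg (sq_nonneg (d k : ℝ)), div_le_div_iff₀ (by positivity)
        (by positivity)]
      have e3 := hclose k hk n₀ hn₀
      calc |(k : ℝ) - n₀| * (Q * D ^ 2) = (|(k : ℝ) - n₀| * Q) * D ^ 2 := by ring
        _ ≤ B * Y * (d k : ℝ) ^ 2 := by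
          have := hsq k hk
          gcongr
    have r1 := abs_le.1 (happ n hn)
    have r2 := abs_le.1 (happ n' hn')
    have hfin : ((s n' : ℝ) - s n) * α (s n / L) - z =
        -(((m n' : ℝ) - n₀ / (d n' : ℝ) ^ 2) - ((m n : ℝ) - n₀ / (d n : ℝ) ^ 2) +
          ((n₀ / (d n' : ℝ) ^ 2 - n₀ / u ^ 2 + 2 * n₀ * h' / u ^ 3) -
          (n₀ / (d n : ℝ) ^ 2 - n₀ / u ^ 2 + 2 * n₀ * h / u ^ 3))) / Q := by
      have hz' : (z : ℝ) = ((m n' : ℝ) - m n + (h' - h) * c) / Q := by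
        rw [hhd, hz]; field_simp
      have : ((s n' : ℝ) - s n) = (h' - h) / R := by rw [hhd]; field_simp
      rw [this, hz', hαi]
      field_simp
      ring
    rw [hfin, hδ, abs_div, abs_of_pos hQ']
    gcongr
    have hsplit : 2 * (B * Y) / (Q * D ^ 2) = 2 * ((B * Y) / (Q * D ^ 2)) := by ring
    rw [hsplit, abs_le]
    constructor <;> linarith
  · intro i hi j hj
    by_cases hij : i = j
    · simp [hij, hV0]
    · exact (hαabs i hi j hj hij).2

theorem sum_Ico_inv_le_one_add_log (L : ℕ) :
    ∑ j ∈ Finset.Ico 1 L, (1 : ℝ) / j ≤ 1 + Real.log L := by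
  refine le_trans ?_ (harmonic_le_one_add_log L)
  rw [harmonic_eq_sum_Icc]
  push_cast
  simp only [one_div]
  apply Finset.sum_le_sum_of_subset_of_nonneg
  · intro j hj
    simp only [Finset.mem_Ico, Finset.mem_Icc] at *
    omega
  · intros
    positivity

theorem sum_Ico_mul_le {L : ℕ} {V δ μ : ℝ} (hV : 0 ≤ V) (hδ : 0 ≤ δ) (hμ : 0 < μ) :
    ∑ j ∈ Finset.Ico 1 L, (j * V + 2 * δ + 1) * (2 * δ / (j * μ) + 1) ≤
      L * (2 * δ * V / μ) + L ^ 2 * V + (2 * δ + 1) * (2 * δ / μ) * (1 + Real.log L) +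
        L * (2 * δ + 1) := by
  calc ∑ j ∈ Finset.Ico 1 L, (j * V + 2 * δ + 1) * (2 * δ / (j * μ) + 1)
      ≤ ∑ j ∈ Finset.Ico 1 L, (2 * δ * V / μ + L * V + (2 * δ + 1) * (2 * δ / μ) * (1 / j) +
          (2 * δ + 1)) := by
        apply Finset.sum_le_sum
        intro j hj
        obtain ⟨h1, h2⟩ := Finset.mem_Ico.1 hj
        have hj0 : (0 : ℝ) < j := by exact_mod_cast h1
        have hjL : (j : ℝ) * V ≤ L * V := by gcongr
        have : (j * V + 2 * δ + 1) * (2 * δ / (j * μ) + 1) = 2 * δ * V / μ + j * V +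
            (2 * δ + 1) * (2 * δ / μ) * (1 / j) + (2 * δ + 1) := by
          field_simp
          ring
        linarith
    _ = (L - 1 : ℕ) * (2 * δ * V / μ) + (L - 1 : ℕ) * (L * V) +
          (2 * δ + 1) * (2 * δ / μ) * (∑ j ∈ Finset.Ico 1 L, (1 : ℝ) / j) +
          (L - 1 : ℕ) * (2 * δ + 1) := by
        simp only [Finset.sum_add_distrib, Finset.sum_const, Nat.card_Ico, nsmul_eq_mul,
          Finset.mul_sum]
        ring
    _ ≤ L * (2 * δ * V / μ) + L * (L * V) +
          (2 * δ + 1) * (2 * δ / μ) * (1 + Real.log L) + L * (2 * δ + 1) := by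
        have : ((L - 1 : ℕ) : ℝ) ≤ L := by exact_mod_cast Nat.sub_le L 1
        have := sum_Ico_inv_le_one_add_log L
        gcongr
    _ = _ := by ring

theorem Finset.card_le_of_sq_dvd_of_coprime (P : Finset ℕ) (d : ℕ → ℕ) {B Y D δ μ V : ℝ}
    {Q R L : ℕ}
    (hQ : 0 < Q) (hR : 0 < R) (hL : 0 < L) (hQR : Q ∣ R ^ 2)
    (hB : 0 ≤ B) (hY0 : 0 < Y) (hD0 : 0 < D) (hY : ∀ n ∈ P, Y ≤ n) (hBY : ∀ n ∈ P, (n : ℝ) ≤ B * Y)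
    (hD : ∀ n ∈ P, D ≤ d n) (hD' : ∀ n ∈ P, (d n : ℝ) ≤ 2 * D) (hdvd : ∀ n ∈ P, d n ^ 2 ∣ n)
    (hcop : ∀ n ∈ P, (d n).Coprime Q) (hQD : B * Y < Q ^ 2 * D ^ 2)
    (hclose : ∀ n ∈ P, ∀ n' ∈ P, n ≡ n' [MOD Q] → |(n : ℝ) - n'| * Q ≤ B * Y)
    (hδ : δ = (2 * (B * Y) / (Q * D ^ 2) + 3 * (B * Y) * (R * L) ^ 2 / D ^ 4) / Q)
    (hμ : μ = R / Q * (2 * Y * (3 * (R * L) / (2 * D) ^ 4)))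
    (hV : V = R / Q * (2 * (B * Y) * (3 * D / D ^ 4))) :
    (P.card : ℝ) ≤ Q * R * (D / (R * L) + 1 + (L * (2 * δ * V / μ) + L ^ 2 * V +
      (2 * δ + 1) * (2 * δ / μ) * (1 + Real.log L) + L * (2 * δ + 1))) := by
  classical
  have hQ' : (0 : ℝ) < Q := by exact_mod_cast hQ
  have hR' : (0 : ℝ) < R := by exact_mod_cast hR
  have hL' : (0 : ℝ) < L := by exact_mod_cast hL
  have hδ0 : 0 ≤ δ := by rw [hδ]; positivity
  have hμ0 : 0 < μ := by rw [hμ]; positivity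
  have hV0 : 0 ≤ V := by rw [hV]; positivity
  have hlog : 0 ≤ Real.log L := Real.log_natCast_nonneg L
  apply Finset.card_le_mul_of_fibers P (fun n => (n % Q, d n % R)) (by positivity)
  · have hsub : P.image (fun n => (n % Q, d n % R)) ⊆ Finset.range Q ×ˢ Finset.range R := by
      intro x hx
      obtain ⟨n, _, rfl⟩ := Finset.mem_image.1 hx
      simp [Nat.mod_lt, hQ, hR]
    have := Finset.card_le_card hsub
    rw [Finset.card_product, Finset.card_range, Finset.card_range] at this
    exact_mod_cast this
  · intro c _
    have hmem : ∀ n ∈ P.filter (fun n => (n % Q, d n % R) = c), n ∈ P :=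
      fun n hn => (Finset.mem_filter.1 hn).1
    have heq : ∀ n ∈ P.filter (fun n => (n % Q, d n % R) = c), (n % Q, d n % R) = c :=
      fun n hn => (Finset.mem_filter.1 hn).2
    have hmodQ : ∀ n ∈ P.filter (fun n => (n % Q, d n % R) = c),
        ∀ n' ∈ P.filter (fun n => (n % Q, d n % R) = c), n ≡ n' [MOD Q] := fun n hn n' hn' =>
      congrArg Prod.fst ((heq n hn).trans (heq n' hn').symm)
    refine (Finset.card_class_le_of_sq_dvd _ d hQ hR hL hQR hB hY0 hD0
      (fun n hn => hY n (hmem n hn)) (fun n hn => hBY n (hmem n hn))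
      (fun n hn => hD n (hmem n hn)) (fun n hn => hD' n (hmem n hn))
      (fun n hn => hdvd n (hmem n hn)) (fun n hn => hcop n (hmem n hn)) hQD hmodQ
      (fun n hn n' hn' => congrArg Prod.snd ((heq n hn).trans (heq n' hn').symm))
      (fun n hn n' hn' => hclose n (hmem n hn) n' (hmem n' hn') (hmodQ n hn n' hn'))
      hδ hμ hV).trans ?_
    gcongr
    exact sum_Ico_mul_le hV0 hδ0 hμ0

/-- The second-derivative bound with its parameters balanced. -/
theorem balanced_parameters_bound {B U E D Q R L H K δ μ V : ℝ} (hB : 2 ≤ B) (hU : 0 < U)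
    (hE : 1 ≤ E) (hD : 0 < D) (hQ : 0 < Q) (hR : 0 < R) (hH : 1 ≤ H) (hK : 0 ≤ K)
    (hQ1 : B * U * E ≤ Q * D) (hQ2 : Q * D ≤ B ^ 2 * U * E)
    (hR1 : B ^ 2 * D ^ 3 ≤ R ^ 2 * U * E ^ 5) (hR2 : R ^ 2 * U * E ^ 5 ≤ B ^ 4 * D ^ 3)
    (hL1 : E ^ 2 ≤ L) (hL2 : L ≤ 2 * E ^ 2) (hDH : D * E ^ 3 * H ^ 2 ≤ K ^ 2 * U)
    (hδ : δ = (2 * (B * U ^ 2) / (Q * D ^ 2) + 3 * (B * U ^ 2) * (R * L) ^ 2 / D ^ 4) / Q)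
    (hμ : μ = R / Q * (2 * U ^ 2 * (3 * (R * L) / (2 * D) ^ 4)))
    (hV : V = R / Q * (2 * (B * U ^ 2) * (3 * D / D ^ 4))) :
    Q * R * (D / (R * L) + 1 + (L * (2 * δ * V / μ) + L ^ 2 * V +
      (2 * δ + 1) * (2 * δ / μ) * H + L * (2 * δ + 1))) ≤
    (B ^ 2 + 32 * B ^ 3 * (1 + 12 * B ^ 4) + 24 * B ^ 5 +
      ((2 * (1 + 12 * B ^ 4) + 1) * 6 * (1 + 12 * B ^ 4) + 2 * (1 + 12 * B ^ 4) + 2) *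
        (2 * B ^ 4 * K)) * (U / E) := by
  have hE0 : 0 < E := by linarith
  have hB0 : 0 < B := by linarith
  have hL0 : 0 < L := lt_of_lt_of_le (by positivity) hL1
  have hL1' : 1 ≤ L := le_trans (one_le_pow₀ hE) hL1
  have hH0 : 0 < H := by linarith
  have hδ0 : 0 ≤ δ := by rw [hδ]; positivity
  set K₁ : ℝ := 1 + 12 * B ^ 4 with hK₁
  have hK₁0 : 0 < K₁ := by positivity
  have hδE : δ ≤ K₁ / E ^ 2 := by
    have h1 : 2 * (B * U ^ 2) / (Q * D ^ 2) / Q ≤ 1 / E ^ 2 := by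
      rw [div_div, div_le_div_iff₀ (by positivity) (by positivity)]
      calc 2 * (B * U ^ 2) * E ^ 2 ≤ B * (B * U ^ 2) * E ^ 2 := by gcongr
        _ = (B * U * E) ^ 2 := by ring
        _ ≤ (Q * D) ^ 2 := by gcongr
        _ = _ := by ring
    have h2 : 3 * (B * U ^ 2) * (R * L) ^ 2 / D ^ 4 / Q ≤ 12 * B ^ 4 / E ^ 2 := by
      rw [div_div, div_le_div_iff₀ (by positivity) (by positivity)]
      calc 3 * (B * U ^ 2) * (R * L) ^ 2 * E ^ 2
          ≤ 3 * (B * U ^ 2) * (R * (2 * E ^ 2)) ^ 2 * E ^ 2 := by gcongr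
        _ = 12 * B * U * E * (R ^ 2 * U * E ^ 5) := by ring
        _ ≤ 12 * B * U * E * (B ^ 4 * D ^ 3) := by gcongr
        _ = 12 * B ^ 4 * D ^ 3 * (B * U * E) := by ring
        _ ≤ 12 * B ^ 4 * D ^ 3 * (Q * D) := by gcongr
        _ = _ := by ring
    rw [hδ, hK₁, add_div, add_div]
    exact add_le_add h1 h2
  have hδK : δ ≤ K₁ := hδE.trans (div_le_self hK₁0.le (one_le_pow₀ hE))
  have hX : Q * R * L * H ≤ 2 * B ^ 4 * K * (U / E) := by
    rw [← mul_div_assoc, le_div_iff₀ hE0]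
    have h1 : (Q * R * L * H * E) ^ 2 * (D ^ 2 * U * E ^ 5) ≤
        (2 * B ^ 4 * K * U) ^ 2 * (D ^ 2 * U * E ^ 5) := by
      calc (Q * R * L * H * E) ^ 2 * (D ^ 2 * U * E ^ 5)
          = (Q * D) ^ 2 * (R ^ 2 * U * E ^ 5) * L ^ 2 * (H ^ 2 * E ^ 2) := by ring
        _ ≤ (B ^ 2 * U * E) ^ 2 * (B ^ 4 * D ^ 3) * (2 * E ^ 2) ^ 2 * (H ^ 2 * E ^ 2) := by gcongr
        _ = 4 * B ^ 8 * U ^ 2 * D ^ 2 * E ^ 5 * (D * E ^ 3 * H ^ 2) := by ring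
        _ ≤ 4 * B ^ 8 * U ^ 2 * D ^ 2 * E ^ 5 * (K ^ 2 * U) := by gcongr
        _ = _ := by ring
    have h2 := le_of_mul_le_mul_right h1 (by positivity)
    exact (pow_le_pow_iff_left₀ (by positivity) (by positivity) two_ne_zero).1 h2
  have t1 : Q * R * (D / (R * L)) ≤ B ^ 2 * (U / E) := by
    have : Q * R * (D / (R * L)) = Q * D / L := by field_simp
    rw [this, ← mul_div_assoc, div_le_div_iff₀ hL0 hE0]
    calc Q * D * E ≤ B ^ 2 * U * E * E := by gcongr
      _ = B ^ 2 * U * E ^ 2 := by ring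
      _ ≤ _ := by gcongr
  have t3 : Q * R * (L * (2 * δ * V / μ)) ≤ 32 * B ^ 3 * K₁ * (U / E) := by
    have : Q * R * (L * (2 * δ * V / μ)) = 32 * B * δ * (Q * D) := by
      rw [hV, hμ]
      field_simp
      ring
    rw [this]
    calc 32 * B * δ * (Q * D) ≤ 32 * B * (K₁ / E ^ 2) * (B ^ 2 * U * E) := by gcongr
      _ = _ := by field_simp
  have t4 : Q * R * (L ^ 2 * V) ≤ 24 * B ^ 5 * (U / E) := by
    have : Q * R * (L ^ 2 * V) = 6 * B * U * (R ^ 2 * U) * L ^ 2 / D ^ 3 := by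
      rw [hV]
      field_simp
      ring
    rw [this, ← mul_div_assoc, div_le_div_iff₀ (by positivity) hE0]
    calc 6 * B * U * (R ^ 2 * U) * L ^ 2 * E ≤ 6 * B * U * (R ^ 2 * U) * (2 * E ^ 2) ^ 2 * E := by
          gcongr
      _ = 24 * B * U * (R ^ 2 * U * E ^ 5) := by ring
      _ ≤ 24 * B * U * (B ^ 4 * D ^ 3) := by gcongr
      _ = _ := by ring
  have t5 : Q * R * ((2 * δ + 1) * (2 * δ / μ) * H) ≤ (2 * K₁ + 1) * 6 * K₁ * (Q * R * L * H) := by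
    have h1 : δ * Q * D ^ 4 ≤ K₁ * (U ^ 2 * R ^ 2 * L ^ 2) := by
      calc δ * Q * D ^ 4 ≤ K₁ / E ^ 2 * Q * D ^ 4 := by gcongr
        _ = K₁ / E ^ 2 * (Q * D) * D ^ 3 := by ring
        _ ≤ K₁ / E ^ 2 * (B ^ 2 * U * E) * D ^ 3 := by gcongr
        _ = K₁ * U / E * (B ^ 2 * D ^ 3) := by field_simp
        _ ≤ K₁ * U / E * (R ^ 2 * U * E ^ 5) := by gcongr
        _ = K₁ * (U ^ 2 * R ^ 2 * (E ^ 2) ^ 2) := by field_simp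
        _ ≤ _ := by gcongr
    have h2 : 2 * δ / μ ≤ 6 * K₁ * L := by
      have : 2 * δ / μ = 16 / 3 * (δ * Q * D ^ 4) / (U ^ 2 * R ^ 2 * L) := by
        rw [hμ]
        field_simp
        ring
      rw [this, div_le_iff₀ (by positivity)]
      have : 0 ≤ K₁ * (U ^ 2 * R ^ 2 * L ^ 2) := by positivity
      nlinarith
    have hμ0 : 0 < μ := by rw [hμ]; positivity
    calc Q * R * ((2 * δ + 1) * (2 * δ / μ) * H)
        ≤ Q * R * ((2 * K₁ + 1) * (6 * K₁ * L) * H) := by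
          gcongr
      _ = _ := by ring
  have t6 : Q * R * (1 + L * (2 * δ + 1)) ≤ (2 * K₁ + 2) * (Q * R * L * H) := by
    calc Q * R * (1 + L * (2 * δ + 1)) ≤ Q * R * (L + L * (2 * K₁ + 1)) := by gcongr
      _ = (2 * K₁ + 2) * (Q * R * L * 1) := by ring
      _ ≤ _ := by gcongr
  have hcoef : 0 ≤ (2 * K₁ + 1) * 6 * K₁ + 2 * K₁ + 2 := by positivity
  have t7 := mul_le_mul_of_nonneg_left hX hcoef
  calc _ = Q * R * (D / (R * L)) + Q * R * (L * (2 * δ * V / μ)) + Q * R * (L ^ 2 * V) +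
        Q * R * ((2 * δ + 1) * (2 * δ / μ) * H) + Q * R * (1 + L * (2 * δ + 1)) := by ring
    _ ≤ B ^ 2 * (U / E) + 32 * B ^ 3 * K₁ * (U / E) + 24 * B ^ 5 * (U / E) +
        (2 * K₁ + 1) * 6 * K₁ * (Q * R * L * H) + (2 * K₁ + 2) * (Q * R * L * H) := by gcongr
    _ ≤ _ := by linarith

theorem Finset.card_le_of_sq_dvd_of_large {b : ℕ} (hb : 2 ≤ b) {ε Y D : ℝ} (hY1 : 1 ≤ Y)
    (hε : 0 < ε) (hYD : Y ^ ((1 : ℝ) / 3 + 2 * ε / 3) ≤ D) (P : Finset ℕ) (d : ℕ → ℕ)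
    (hY : ∀ n ∈ P, Y ≤ n) (hBY : ∀ n ∈ P, (n : ℝ) ≤ b * Y)
    (hD : ∀ n ∈ P, D ≤ d n) (hD' : ∀ n ∈ P, (d n : ℝ) ≤ 2 * D) (hdvd : ∀ n ∈ P, d n ^ 2 ∣ n)
    (hclose : ∀ n ∈ P, ∀ n' ∈ P, ∀ k, n ≡ n' [MOD b ^ k] →
      |(n : ℝ) - n'| * (b ^ k : ℕ) ≤ b * Y) :
    (P.card : ℝ) ≤ b * (2 * b ^ 3 + 1) * Y ^ ((1 : ℝ) / 2 - ε) := by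
  have hb0 : (0 : ℝ) < b := by positivity
  have hY0 : 0 < Y := by linarith
  have hD1 : 1 ≤ D := le_trans (Real.one_le_rpow hY1 (by positivity)) hYD
  have hD0 : 0 < D := by linarith
  have hs1 : 1 ≤ √D := Real.one_le_sqrt.2 hD1
  have hs0 : 0 < √D := by linarith
  obtain ⟨k, hk1, hk2⟩ := exists_nat_pow_near hs1 (show (1 : ℝ) < b by exact_mod_cast hb)
  have key := Finset.card_le_of_sq_dvd P d (Q := b ^ k) (by positivity) hb0.le hY0 hD0 hY hBY hD hD'
    hdvd (fun n hn n' hn' h => hclose n hn n' hn' k h)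
  push_cast at key
  set Q : ℝ := (b : ℝ) ^ k
  have hQ0 : 0 < Q := by positivity
  have hsD : √D ^ 2 = D := Real.sq_sqrt hD0.le
  have h1 : 2 * b * D / Q / Q ≤ 2 * b ^ 3 := by
    rw [div_div, div_le_iff₀ (by positivity)]
    calc 2 * b * D = 2 * b * √D ^ 2 := by rw [hsD]
      _ ≤ 2 * b * (Q * b) ^ 2 := by
        rw [pow_succ] at hk2
        gcongr
      _ = _ := by ring
  have h2 : Y ^ ((1 : ℝ) / 2 + ε) ≤ √D ^ 3 := by
    have h3 : √D ^ 3 = D ^ ((3 : ℝ) / 2) := by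
      rw [Real.sqrt_eq_rpow, ← Real.rpow_natCast, ← Real.rpow_mul hD0.le]
      norm_num
    rw [h3]
    calc Y ^ ((1 : ℝ) / 2 + ε) = (Y ^ ((1 : ℝ) / 3 + 2 * ε / 3)) ^ ((3 : ℝ) / 2) := by
          rw [← Real.rpow_mul hY0.le]
          ring_nf
      _ ≤ _ := by gcongr
  have h3 : Y / √D ^ 3 ≤ Y ^ ((1 : ℝ) / 2 - ε) := by
    rw [div_le_iff₀ (by positivity)]
    calc Y = Y ^ ((1 : ℝ) / 2 - ε) * Y ^ ((1 : ℝ) / 2 + ε) := by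
          rw [← Real.rpow_add hY0]
          norm_num
      _ ≤ _ := by gcongr
  calc (P.card : ℝ) ≤ _ := key
    _ ≤ (b * Y / D ^ 2 * √D) * (2 * b ^ 3 + 1) := by gcongr
    _ = b * (2 * b ^ 3 + 1) * (Y / √D ^ 3) := by
      conv_lhs => rw [← hsD]
      simp only [Real.sqrt_sq hs0.le]
      field_simp
    _ ≤ _ := by gcongr

theorem one_add_log_two_mul_le {Y : ℝ} (hY : 1 ≤ Y) :
    1 + Real.log (2 * Y) ≤ 58 * Y ^ ((1 : ℝ) / 56) := by
  have hY0 : 0 < Y := by linarith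
  have h1 := Real.log_le_rpow_div hY0.le (show (0 : ℝ) < 1 / 56 by norm_num)
  have h2 := Real.log_two_lt_d9
  have h3 := Real.one_le_rpow hY (show (0 : ℝ) ≤ 1 / 56 by norm_num)
  rw [Real.log_mul (by norm_num) hY0.ne']
  linarith

theorem Finset.card_le_of_sq_dvd_of_small {b : ℕ} (hb : 2 ≤ b) {ε Y D : ℝ} (hY1 : 1 ≤ Y)
    (hε : 0 < ε) (hYD : Y ^ ((1 : ℝ) / 4 + 3 * ε) ≤ D) (hDY : D < Y ^ ((1 : ℝ) / 3 + 2 * ε / 3))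
    (P : Finset ℕ) (d : ℕ → ℕ)
    (hY : ∀ n ∈ P, Y ≤ n) (hBY : ∀ n ∈ P, (n : ℝ) ≤ b * Y)
    (hD : ∀ n ∈ P, D ≤ d n) (hD' : ∀ n ∈ P, (d n : ℝ) ≤ 2 * D) (hdvd : ∀ n ∈ P, d n ^ 2 ∣ n)
    (hcop : ∀ n ∈ P, (d n).Coprime b)
    (hclose : ∀ n ∈ P, ∀ n' ∈ P, ∀ k, n ≡ n' [MOD b ^ k] →
      |(n : ℝ) - n'| * (b ^ k : ℕ) ≤ b * Y) :
    (P.card : ℝ) ≤ ((b : ℝ) ^ 2 + 32 * b ^ 3 * (1 + 12 * b ^ 4) + 24 * b ^ 5 +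
      ((2 * (1 + 12 * b ^ 4) + 1) * 6 * (1 + 12 * b ^ 4) + 2 * (1 + 12 * b ^ 4) + 2) *
        (2 * b ^ 4 * 58)) * Y ^ ((1 : ℝ) / 2 - ε) := by
  have hb2 : (2 : ℝ) ≤ b := by exact_mod_cast hb
  have hb1 : (1 : ℝ) < b := by linarith
  have hb0 : (0 : ℝ) < b := by linarith
  have hY0 : 0 < Y := by linarith
  have hD1 : 1 ≤ D := le_trans (Real.one_le_rpow hY1 (by positivity)) hYD
  have hD0 : 0 < D := by linarith
  have hYgt : 1 < Y := by
    refine lt_of_le_of_ne hY1 fun h => ?_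
    rw [← h, Real.one_rpow] at hDY
    linarith
  have hε28 : ε < 1 / 28 := by
    have := (Real.rpow_lt_rpow_left_iff hYgt).1 (hYD.trans_lt hDY)
    linarith
  set U : ℝ := Y ^ ((1 : ℝ) / 2) with hU
  set E : ℝ := Y ^ ε with hE
  have hU0 : 0 < U := by positivity
  have hE1 : 1 ≤ E := Real.one_le_rpow hY1 hε.le
  have hE0 : 0 < E := by linarith
  have hUpow : ∀ k : ℕ, U ^ k = Y ^ ((1 : ℝ) / 2 * k) := fun k => by
    rw [hU, Real.rpow_mul hY0.le, Real.rpow_natCast]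
  have hEpow : ∀ k : ℕ, E ^ k = Y ^ (ε * k) := fun k => by
    rw [hE, Real.rpow_mul hY0.le, Real.rpow_natCast]
  have hU2 : U ^ 2 = Y := by
    rw [hUpow]
    norm_num
  have hD4 : U ^ 2 * E ^ 12 ≤ D ^ 4 := by
    calc U ^ 2 * E ^ 12 = (Y ^ ((1 : ℝ) / 4 + 3 * ε)) ^ 4 := by
          rw [hUpow, hEpow, ← Real.rpow_add hY0, ← Real.rpow_natCast, ← Real.rpow_mul hY0.le]
          push_cast
          ring_nf
      _ ≤ _ := by gcongr
  have hDU : D ≤ U := hDY.le.trans (Real.rpow_le_rpow_of_exponent_le hY1 (by linarith))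
  have ht1 : 1 ≤ U * E / D := by
    rw [one_le_div hD0]
    nlinarith
  have hρt : U * E / D ≤ D ^ 3 / (U * E ^ 5) := by
    rw [div_le_div_iff₀ hD0 (by positivity)]
    calc U * E * (U * E ^ 5) = U ^ 2 * E ^ 6 := by ring
      _ ≤ U ^ 2 * E ^ 12 := by
        gcongr
        norm_num
      _ ≤ D ^ 4 := hD4
      _ = _ := by ring
  have hρ1 : 1 ≤ √(D ^ 3 / (U * E ^ 5)) := Real.one_le_sqrt.2 (ht1.trans hρt)
  have hρ2 : √(D ^ 3 / (U * E ^ 5)) ^ 2 = D ^ 3 / (U * E ^ 5) := Real.sq_sqrt (by positivity)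
  obtain ⟨k, hk1, hk2⟩ := exists_nat_pow_near ht1 hb1
  obtain ⟨r, hr1, hr2⟩ := exists_nat_pow_near hρ1 hb1
  have hL1 : E ^ 2 ≤ ⌈E ^ 2⌉₊ := Nat.le_ceil _
  have hL2 : (⌈E ^ 2⌉₊ : ℝ) ≤ 2 * E ^ 2 := by
    have := Nat.ceil_lt_add_one (show 0 ≤ E ^ 2 by positivity)
    have : 1 ≤ E ^ 2 := one_le_pow₀ hE1
    linarith
  set ρ : ℝ := √(D ^ 3 / (U * E ^ 5))
  have hρ0 : 0 < ρ := by linarith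
  have hQ1 : b * (U * E / D) < (b : ℝ) ^ (k + 2) := by
    calc b * (U * E / D) < b * (b : ℝ) ^ (k + 1) := by gcongr
      _ = _ := by ring
  have hQ2 : (b : ℝ) ^ (k + 2) ≤ b ^ 2 * (U * E / D) := by
    calc (b : ℝ) ^ (k + 2) = b ^ 2 * b ^ k := by ring
      _ ≤ _ := by gcongr
  have hR1 : b * ρ < (b : ℝ) ^ (r + 2) := by
    calc b * ρ < b * (b : ℝ) ^ (r + 1) := by gcongr
      _ = _ := by ring
  have hR2 : (b : ℝ) ^ (r + 2) ≤ b ^ 2 * ρ := by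
    calc (b : ℝ) ^ (r + 2) = b ^ 2 * b ^ r := by ring
      _ ≤ _ := by gcongr
  have hQR : b ^ (k + 2) ∣ (b ^ (r + 2)) ^ 2 := by
    rw [← pow_mul]
    apply pow_dvd_pow
    have : (b : ℝ) ^ (k + 2) < b ^ ((r + 2) * 2) := by
      calc (b : ℝ) ^ (k + 2) ≤ b ^ 2 * (U * E / D) := hQ2
        _ ≤ b ^ 2 * ρ ^ 2 := by
          rw [hρ2]
          gcongr
        _ = (b * ρ) ^ 2 := by ring
        _ < (b ^ (r + 2)) ^ 2 := by gcongr
        _ = _ := by rw [← pow_mul]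
    exact ((pow_lt_pow_iff_right₀ hb1).1 this).le
  have hQ1' : b * U * E < (b : ℝ) ^ (k + 2) * D := by
    rw [← div_lt_iff₀ hD0]
    calc b * U * E / D = b * (U * E / D) := by ring
      _ < _ := hQ1
  have hQ2' : (b : ℝ) ^ (k + 2) * D ≤ b ^ 2 * U * E := by
    rw [← le_div_iff₀ hD0]
    calc _ ≤ _ := hQ2
      _ = _ := by ring
  have hQD : (b : ℝ) * Y < ((b ^ (k + 2) : ℕ) : ℝ) ^ 2 * D ^ 2 := by
    push_cast
    calc (b : ℝ) * Y = b * U ^ 2 * 1 * 1 := by rw [hU2]; ring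
      _ ≤ b * U ^ 2 * b * E ^ 2 := by
        gcongr
        exact one_le_pow₀ hE1
      _ = (b * U * E) ^ 2 := by ring
      _ < (b ^ (k + 2) * D) ^ 2 := by gcongr
      _ = _ := by ring
  have hρD : ρ ^ 2 * U * E ^ 5 = D ^ 3 := by
    rw [hρ2]
    field_simp
  have hR1' : (b : ℝ) ^ 2 * D ^ 3 ≤ (b ^ (r + 2)) ^ 2 * U * E ^ 5 := by
    calc (b : ℝ) ^ 2 * D ^ 3 = (b * ρ) ^ 2 * U * E ^ 5 := by rw [← hρD]; ring
      _ ≤ _ := by gcongr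
  have hR2' : ((b : ℝ) ^ (r + 2)) ^ 2 * U * E ^ 5 ≤ b ^ 4 * D ^ 3 := by
    calc _ ≤ (b ^ 2 * ρ) ^ 2 * U * E ^ 5 := by gcongr
      _ = _ := by rw [← hρD]; ring
  have hL0 : 0 < ⌈E ^ 2⌉₊ := Nat.ceil_pos.2 (by positivity)
  have hH1 : 1 + Real.log ⌈E ^ 2⌉₊ ≤ 58 * Y ^ ((1 : ℝ) / 56) := by
    refine le_trans ?_ (one_add_log_two_mul_le hY1)
    have : E ^ 2 ≤ Y := by
      calc E ^ 2 = Y ^ (ε * (2 : ℕ)) := hEpow 2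
        _ ≤ Y ^ (1 : ℝ) := Real.rpow_le_rpow_of_exponent_le hY1 (by push_cast; linarith)
        _ = Y := Real.rpow_one Y
    gcongr
    linarith
  have hlog : 0 ≤ Real.log ⌈E ^ 2⌉₊ := Real.log_natCast_nonneg _
  have hDH : D * E ^ 3 * (1 + Real.log ⌈E ^ 2⌉₊) ^ 2 ≤ 58 ^ 2 * U := by
    calc D * E ^ 3 * (1 + Real.log ⌈E ^ 2⌉₊) ^ 2
        ≤ Y ^ ((1 : ℝ) / 3 + 2 * ε / 3) * E ^ 3 * (58 * Y ^ ((1 : ℝ) / 56)) ^ 2 := by gcongr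
      _ = 58 ^ 2 * Y ^ ((1 : ℝ) / 3 + 2 * ε / 3 + ε * (3 : ℕ) + 1 / 56 * (2 : ℕ)) := by
        rw [hEpow, mul_pow, ← Real.rpow_mul_natCast hY0.le,
          Real.rpow_add hY0 _ (1 / 56 * _), Real.rpow_add hY0 _ (ε * _)]
        ring
      _ ≤ 58 ^ 2 * U := by
        gcongr
        apply Real.rpow_le_rpow_of_exponent_le hY1
        push_cast
        linarith
  have key := Finset.card_le_of_sq_dvd_of_coprime P d (Q := b ^ (k + 2)) (R := b ^ (r + 2))
    (by positivity) (by positivity) hL0 hQR hb0.le hY0 hD0 hY hBY hD hD' hdvd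
    (fun n hn => (hcop n hn).pow_right _) hQD (fun n hn n' hn' h => hclose n hn n' hn' _ h)
    rfl rfl rfl
  have hUE : Y ^ ((1 : ℝ) / 2 - ε) = U / E := Real.rpow_sub hY0 _ _
  rw [hUE]
  refine key.trans ?_
  push_cast
  exact balanced_parameters_bound hb2 hU0 hE1 hD0 (by positivity) (by positivity) (by linarith)
    (by norm_num) hQ1'.le hQ2' hR1' hR2' hL1 hL2 hDH (by rw [hU2]) (by rw [hU2]) (by rw [hU2])

theorem Finset.exists_card_le_of_sq_dvd {b : ℕ} (hb : 2 ≤ b) {ε : ℝ} (hε : 0 < ε) :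
    ∃ C : ℝ, 0 ≤ C ∧ ∀ Y D : ℝ, 1 ≤ Y → Y ^ ((1 : ℝ) / 4 + 3 * ε) ≤ D →
      ∀ (P : Finset ℕ) (d : ℕ → ℕ), (∀ n ∈ P, Y ≤ n) → (∀ n ∈ P, (n : ℝ) ≤ b * Y) →
      (∀ n ∈ P, D ≤ d n) → (∀ n ∈ P, (d n : ℝ) ≤ 2 * D) → (∀ n ∈ P, d n ^ 2 ∣ n) →
      (∀ n ∈ P, (d n).Coprime b) →
      (∀ n ∈ P, ∀ n' ∈ P, ∀ k, n ≡ n' [MOD b ^ k] →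
        |(n : ℝ) - n'| * (b ^ k : ℕ) ≤ b * Y) →
      (P.card : ℝ) ≤ C * Y ^ ((1 : ℝ) / 2 - ε) := by
  refine ⟨max (b * (2 * b ^ 3 + 1)) ((b : ℝ) ^ 2 + 32 * b ^ 3 * (1 + 12 * b ^ 4) + 24 * b ^ 5 +
      ((2 * (1 + 12 * b ^ 4) + 1) * 6 * (1 + 12 * b ^ 4) + 2 * (1 + 12 * b ^ 4) + 2) *
        (2 * b ^ 4 * 58)), le_max_of_le_left (by positivity),
    fun Y D hY1 hYD P d hY hBY hD hD' hdvd hcop hclose => ?_⟩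
  rcases le_or_gt (Y ^ ((1 : ℝ) / 3 + 2 * ε / 3)) D with h | h
  · refine (Finset.card_le_of_sq_dvd_of_large hb hY1 hε h P d hY hBY hD hD' hdvd hclose).trans ?_
    gcongr
    exact le_max_left _ _
  · refine (Finset.card_le_of_sq_dvd_of_small hb hY1 hε hYD h P d hY hBY hD hD' hdvd hcop
      hclose).trans ?_
    gcongr
    exact le_max_right _ _

theorem PstarSet.coprime_of_sq_dvd {b n d : ℕ} {x : ℝ} (hn : n ∈ PstarSet b x) (hd : d ^ 2 ∣ n) :
    d.Coprime b := by
  have hb : b ∣ b ^ 3 - b := Nat.dvd_sub (dvd_pow_self b three_ne_zero) dvd_rfl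
  exact Nat.Coprime.coprime_dvd_right hb
    (Nat.Coprime.coprime_dvd_left ((dvd_pow_self d two_ne_zero).trans hd) hn.2.2.2)

/-- For all `b ≥ 2` and `ε ∈ (0, 0.25)`, if `x^{1/4+3ε} ≤ D ≤ x^{2/5}` then
`S_b(x,D) ≪_{b,ε} x^{1/2-ε}`. -/
theorem Scount_le_B_process_nontrivial (b : ℕ) (hb : 2 ≤ b) (ε : ℝ)
    (hε : 0 < ε) (hε' : ε < 0.25) :
    ∃ C : ℝ, ∀ x D : ℝ, 1 ≤ x → x ^ ((1 : ℝ) / 4 + 3 * ε) ≤ D → D ≤ x ^ ((2 : ℝ) / 5) →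
      (Scount b x D : ℝ) ≤ C * x ^ ((1 : ℝ) / 2 - ε) := by
  obtain ⟨C, hC, hlen⟩ := Finset.exists_card_le_of_sq_dvd hb hε
  have hb1 : (1 : ℝ) < b := by exact_mod_cast hb
  have hb0 : (0 : ℝ) < b := by linarith
  have hε2 : 0 < (1 : ℝ) / 2 - ε := by norm_num at hε'; linarith
  set q : ℝ := (b : ℝ) ^ ((1 : ℝ) / 2 - ε) with hq
  have hq1 : 1 < q := Real.one_lt_rpow hb1 hε2
  refine ⟨C * (q / (q - 1)), fun x D hx hxD _ => ?_⟩
  have hx0 : 0 < x := by linarith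
  set S : Set ℕ := {n : ℕ | n ∈ PstarSet b x ∧
    ∃ d : ℕ, D ≤ (d : ℝ) ∧ (d : ℝ) ≤ 2 * D ∧ d ^ 2 ∣ n} with hS
  have hfin : S.Finite := (Set.finite_Iic ⌊x⌋₊).subset fun n hn => Nat.le_floor hn.1.2.1
  set P := hfin.toFinset
  have hP : ∀ n ∈ P, n ∈ S := fun n hn => hfin.mem_toFinset.1 hn
  choose! d hdD hdD' hdvd using fun n (hn : n ∈ S) => hn.2
  have hfloor : ⌊x⌋₊ ≠ 0 := (Nat.floor_pos.2 hx).ne'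
  set K := Nat.log b ⌊x⌋₊
  have hKx : (b : ℝ) ^ K ≤ x := by
    calc (b : ℝ) ^ K = ((b ^ K : ℕ) : ℝ) := by push_cast; rfl
      _ ≤ (⌊x⌋₊ : ℝ) := by exact_mod_cast Nat.pow_log_le_self b hfloor
      _ ≤ x := Nat.floor_le hx0.le
  have hmaps : ∀ n ∈ P, Nat.log b n ∈ Finset.range (K + 1) := fun n hn =>
    Finset.mem_range_succ_iff.2 (Nat.log_mono_right (Nat.le_floor (hP n hn).1.2.1))
  have hfiber : ∀ i ∈ Finset.range (K + 1),
      ((P.filter (fun n => Nat.log b n = i)).card : ℝ) ≤ C * q ^ i := by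
    intro i hi
    have hY1 : (1 : ℝ) ≤ (b : ℝ) ^ i := one_le_pow₀ hb1.le
    have hYx : (b : ℝ) ^ i ≤ x :=
      (pow_le_pow_right₀ hb1.le (Finset.mem_range_succ_iff.1 hi)).trans hKx
    have hqi : q ^ i = ((b : ℝ) ^ i) ^ ((1 : ℝ) / 2 - ε) := by
      rw [hq, Real.rpow_pow_comm hb0.le]
    have hmem : ∀ n ∈ P.filter (fun n => Nat.log b n = i), n ∈ S := fun n hn =>
      hP n (Finset.mem_filter.1 hn).1
    have hlog : ∀ n ∈ P.filter (fun n => Nat.log b n = i), Nat.log b n = i := fun n hn =>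
      (Finset.mem_filter.1 hn).2
    have hlength : ∀ n ∈ P.filter (fun n => Nat.log b n = i),
        (Nat.digits b n).length = i + 1 := fun n hn => by
      rw [Nat.length_digits b n hb (hmem n hn).1.1.ne', hlog n hn]
    rw [hqi]
    refine hlen _ D hY1 ((Real.rpow_le_rpow (by positivity) hYx (by positivity)).trans hxD) _ d
      ?_ ?_ (fun n hn => hdD n (hmem n hn)) (fun n hn => hdD' n (hmem n hn))
      (fun n hn => hdvd n (hmem n hn))
      (fun n hn => PstarSet.coprime_of_sq_dvd (hmem n hn).1 (hdvd n (hmem n hn))) ?_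
    · intro n hn
      have := Nat.pow_log_le_self b (hmem n hn).1.1.ne'
      rw [hlog n hn] at this
      exact_mod_cast this
    · intro n hn
      have := Nat.lt_pow_succ_log_self hb n
      rw [hlog n hn, Nat.pow_succ'] at this
      exact_mod_cast this.le
    · intro n hn n' hn' k h
      have := Nat.digits_palindrome_close hb (hmem n hn).1.2.2.1.2 (hmem n' hn').1.2.2.1.2
        (hlength n hn) (hlength n' hn') h
      rw [Nat.pow_succ'] at this
      push_cast at this ⊢
      exact this
  have hcard : Scount b x D = P.card := Set.ncard_eq_toFinset_card _ hfin
  rw [hcard, Finset.card_eq_sum_card_fiberwise hmaps]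
  push_cast
  have hqK : q ^ K ≤ x ^ ((1 : ℝ) / 2 - ε) := by
    rw [hq, Real.rpow_pow_comm hb0.le]
    exact Real.rpow_le_rpow (by positivity) hKx hε2.le
  have hq0 : 0 < q - 1 := by linarith
  calc _ ≤ ∑ i ∈ Finset.range (K + 1), C * q ^ i := Finset.sum_le_sum hfiber
    _ = C * ((q ^ (K + 1) - 1) / (q - 1)) := by rw [← Finset.mul_sum, geom_sum_eq hq1.ne']
    _ ≤ C * (q ^ (K + 1) / (q - 1)) := by
      gcongr
      linarith
    _ = C * (q / (q - 1)) * q ^ K := by ring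
    _ ≤ _ := by gcongr
end
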